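/- Let Γ ⊂ ℂ be a bounded quasicircle with interior Ω whose Riemann map f : 𝔻 → Ω satisfies ∬_𝔻 |f''(z)/f'(z)|² dA(z) < ∞ (i.e., Γ is a Weil–Petersson quasicircle). Then Γ is a chord-arc curve: Γ is rectifiable and there is a constant C > 0 such that ℓ(x,y) ≤ C|x − y| for all x, y ∈ Γ (Radnell–Schippers–Staubach; Bishop). -/

import Mathlib

/-!
STATEMENT 9 (Radnell–Schippers–Staubach; Bishop): a bounded Weil–Petersson quasicircle
(`∬_𝔻 |f''/f'|² dA < ∞` for the interior Riemann map `f`) is a chord-arc curve: it is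
rectifiable and the arclength distance between any two of its points is at most a constant
times the chord distance.
-/

open MeasureTheory Metric Real

/-- A discrete form of the first Lebedev–Milin inequality: if `(n + 1) b (n + 1) = ∑ d k * b (n - k)`
(that is, `b` are the Taylor coefficients of the exponential of a function whose derivative has
Taylor coefficients `d`), then `∑ ‖b n‖ ^ 2 ≤ exp (∑ ‖d k‖ ^ 2 / (k + 1))`. -/
theorem lebedev_milin (d b : ℕ → ℂ) (hb0 : b 0 = 1)
    (hrec : ∀ n : ℕ, ((n : ℂ) + 1) * b (n + 1) = ∑ k ∈ Finset.range (n + 1), d k * b (n - k))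
    (N : ℕ) :
    ∑ n ∈ Finset.range (N + 1), ‖b n‖ ^ 2 ≤
      Real.exp (∑ k ∈ Finset.range N, ‖d k‖ ^ 2 / ((k : ℝ) + 1)) := by
  have hcs : ∀ n : ℕ, ((n : ℝ) + 1) * ‖b (n + 1)‖ ^ 2 ≤
      ∑ k ∈ Finset.range (n + 1), ‖d k‖ ^ 2 * ‖b (n - k)‖ ^ 2 := by
    intro n
    have h1 : ((n : ℝ) + 1) * ‖b (n + 1)‖ ≤ ∑ k ∈ Finset.range (n + 1), ‖d k‖ * ‖b (n - k)‖ := by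
      have h2 : ‖((n : ℂ) + 1) * b (n + 1)‖ = ((n : ℝ) + 1) * ‖b (n + 1)‖ := by
        rw [norm_mul]
        congr 1
        have : ((n : ℂ) + 1) = ((n + 1 : ℕ) : ℂ) := by push_cast; ring
        rw [this, Complex.norm_natCast]; push_cast; ring
      rw [← h2, hrec]
      refine (norm_sum_le _ _).trans (le_of_eq ?_)
      simp
    have h3 : (((n : ℝ) + 1) * ‖b (n + 1)‖) ^ 2 ≤
        ((n : ℝ) + 1) * ∑ k ∈ Finset.range (n + 1), (‖d k‖ * ‖b (n - k)‖) ^ 2 := by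
      refine (pow_le_pow_left₀ (by positivity) h1 2).trans ?_
      have := sq_sum_le_card_mul_sum_sq (s := Finset.range (n + 1))
        (f := fun k => ‖d k‖ * ‖b (n - k)‖)
      simpa using this
    have hn : (0 : ℝ) < n + 1 := by positivity
    simp only [mul_pow] at h3
    refine le_of_mul_le_mul_left ?_ hn
    nlinarith [h3]
  set S : ℝ → ℝ := fun x => ∑ n ∈ Finset.range (N + 1), ‖b n‖ ^ 2 * x ^ n with hS
  set Q : ℝ → ℝ := fun x => ∑ k ∈ Finset.range N, ‖d k‖ ^ 2 / ((k : ℝ) + 1) * x ^ (k + 1) with hQ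
  have hSd : ∀ x, HasDerivAt S
      (∑ n ∈ Finset.range N, ((n : ℝ) + 1) * ‖b (n + 1)‖ ^ 2 * x ^ n) x := by
    intro x
    have : HasDerivAt S (∑ n ∈ Finset.range (N + 1), ‖b n‖ ^ 2 * (n * x ^ (n - 1))) x := by
      rw [hS]
      exact HasDerivAt.fun_sum fun n _ => (hasDerivAt_pow n x).const_mul _
    convert this using 1
    rw [Finset.sum_range_succ']
    simp only [Nat.cast_zero, zero_mul, mul_zero, add_zero, Nat.add_sub_cancel]
    refine Finset.sum_congr rfl fun n _ => ?_
    push_cast; ring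
  have hQd : ∀ x, HasDerivAt Q (∑ k ∈ Finset.range N, ‖d k‖ ^ 2 * x ^ k) x := by
    intro x
    have : HasDerivAt Q (∑ k ∈ Finset.range N,
        ‖d k‖ ^ 2 / ((k : ℝ) + 1) * ((k + 1 : ℕ) * x ^ (k + 1 - 1))) x := by
      rw [hQ]
      exact HasDerivAt.fun_sum fun n _ => (hasDerivAt_pow (n + 1) x).const_mul _
    convert this using 1
    refine Finset.sum_congr rfl fun n _ => ?_
    have : (n : ℝ) + 1 ≠ 0 := by positivity
    push_cast
    field_simp
  have hkey : ∀ x, 0 ≤ x → (∑ n ∈ Finset.range N, ((n : ℝ) + 1) * ‖b (n + 1)‖ ^ 2 * x ^ n) ≤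
      (∑ k ∈ Finset.range N, ‖d k‖ ^ 2 * x ^ k) * S x := by
    intro x hx
    calc (∑ n ∈ Finset.range N, ((n : ℝ) + 1) * ‖b (n + 1)‖ ^ 2 * x ^ n)
        ≤ ∑ n ∈ Finset.range N, ∑ k ∈ Finset.range (n + 1),
            (‖d k‖ ^ 2 * x ^ k) * (‖b (n - k)‖ ^ 2 * x ^ (n - k)) := by
          refine Finset.sum_le_sum fun n _ => ?_
          refine (mul_le_mul_of_nonneg_right (hcs n) (pow_nonneg hx n)).trans (le_of_eq ?_)
          rw [Finset.sum_mul]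
          refine Finset.sum_congr rfl fun k hk => ?_
          have hkn : k ≤ n := Nat.lt_succ_iff.mp (Finset.mem_range.mp hk)
          rw [show x ^ n = x ^ k * x ^ (n - k) by rw [← pow_add, Nat.add_sub_cancel' hkn]]
          ring
      _ = ∑ k ∈ Finset.range N, ∑ m ∈ Finset.range (N - k),
            (‖d k‖ ^ 2 * x ^ k) * (‖b m‖ ^ 2 * x ^ m) := by
          exact Finset.sum_range_diag_flip N fun k m => (‖d k‖ ^ 2 * x ^ k) * (‖b m‖ ^ 2 * x ^ m)
      _ ≤ ∑ k ∈ Finset.range N, (‖d k‖ ^ 2 * x ^ k) * S x := by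
          refine Finset.sum_le_sum fun k _ => ?_
          rw [← Finset.mul_sum]
          refine mul_le_mul_of_nonneg_left ?_ (by positivity)
          refine Finset.sum_le_sum_of_subset_of_nonneg ?_ fun _ _ _ => by positivity
          exact Finset.range_mono (by omega)
      _ = _ := by rw [Finset.sum_mul]
  have hanti : AntitoneOn (fun x => S x * Real.exp (-Q x)) (Set.Icc 0 1) := by
    have hder : ∀ x, HasDerivAt (fun x => S x * Real.exp (-Q x))
        ((∑ n ∈ Finset.range N, ((n : ℝ) + 1) * ‖b (n + 1)‖ ^ 2 * x ^ n) * Real.exp (-Q x) +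
          S x * (Real.exp (-Q x) * -(∑ k ∈ Finset.range N, ‖d k‖ ^ 2 * x ^ k))) x :=
      fun x => (hSd x).mul ((hQd x).neg.exp)
    refine antitoneOn_of_deriv_nonpos (convex_Icc 0 1)
      (fun x _ => (hder x).continuousAt.continuousWithinAt)
      (fun x _ => (hder x).differentiableAt.differentiableWithinAt) fun x hx => ?_
    rw [interior_Icc] at hx
    rw [(hder x).deriv]
    have := mul_le_mul_of_nonneg_right (hkey x hx.1.le) (Real.exp_pos (-Q x)).le
    nlinarith [this]
  have h01 := hanti (Set.left_mem_Icc.2 zero_le_one) (Set.right_mem_Icc.2 zero_le_one) zero_le_one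
  have hS0 : S 0 = 1 := by
    rw [hS]; simp [Finset.sum_range_succ', hb0]
  have hQ0 : Q 0 = 0 := by rw [hQ]; simp
  have hS1 : S 1 = ∑ n ∈ Finset.range (N + 1), ‖b n‖ ^ 2 := by rw [hS]; simp
  have hQ1 : Q 1 = ∑ k ∈ Finset.range N, ‖d k‖ ^ 2 / ((k : ℝ) + 1) := by rw [hQ]; simp
  simp only [hS0, hQ0, neg_zero, Real.exp_zero, mul_one] at h01
  rw [Real.exp_neg, mul_inv_le_iff₀ (Real.exp_pos _), one_mul] at h01
  rwa [hS1, hQ1] at h01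

/-- Parseval's identity on the circle of radius `r < 1` for the sum of a power series that
converges on the unit disk. -/
theorem hasSum_norm_sq_coeff_mul_pow {f : ℂ → ℂ} {c : ℕ → ℂ}
    (hf : ∀ z ∈ ball (0 : ℂ) 1, HasSum (fun n => c n * z ^ n) (f z)) {r : ℝ} (hr0 : 0 ≤ r)
    (hr1 : r < 1) :
    HasSum (fun n => ‖c n‖ ^ 2 * r ^ (2 * n))
      ((2 * π)⁻¹ * ∫ θ in (0 : ℝ)..2 * π, ‖f (circleMap 0 r θ)‖ ^ 2) := by
  rw [hasSum_iff_tendsto_nat_of_nonneg fun n => by positivity]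
  set P : ℕ → ℝ → ℂ := fun N θ => ∑ n ∈ Finset.range N, c n * (circleMap 0 r θ) ^ n with hP
  have hmem : ∀ θ, circleMap 0 r θ ∈ ball (0 : ℂ) 1 := fun θ => by
    simp [abs_of_nonneg hr0, hr1]
  have hnorm : ∀ n θ, ‖c n * (circleMap 0 r θ) ^ n‖ = ‖c n‖ * r ^ n := fun n θ => by
    simp [abs_of_nonneg hr0]
  have hsum : Summable fun n => ‖c n‖ * r ^ n := by
    have := (hf _ (hmem 0)).summable.norm
    simpa only [hnorm] using this
  have hpars : ∀ N, ∑ n ∈ Finset.range N, ‖c n‖ ^ 2 * r ^ (2 * n) =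
      (2 * π)⁻¹ * ∫ θ in (0 : ℝ)..2 * π, ‖P N θ‖ ^ 2 := by
    intro N
    set p : Polynomial ℂ := ∑ n ∈ Finset.range N, Polynomial.monomial n (c n * (r : ℂ) ^ n) with hp
    have hcoeff : ∀ i, p.coeff i = if i < N then c i * (r : ℂ) ^ i else 0 := by
      intro i
      simp [hp, Polynomial.finsetSum_coeff, Polynomial.coeff_monomial]
    have h1 := p.sum_sq_norm_coeff_eq_circleAverage
    rw [Finset.sum_subset (s₂ := Finset.range N) (fun i hi => ?_) (fun i _ hi => ?_)] at h1
    · rw [Real.circleAverage_def, smul_eq_mul] at h1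
      have h2 : ∀ θ, p.eval (circleMap 0 1 θ) = P N θ := by
        intro θ
        simp only [hp, hP, Polynomial.eval_finsetSum, Polynomial.eval_monomial]
        refine Finset.sum_congr rfl fun n _ => ?_
        simp only [circleMap, zero_add]
        push_cast
        ring
      simp only [h2] at h1
      rw [← h1]
      refine Finset.sum_congr rfl fun i hi => ?_
      rw [hcoeff, if_pos (Finset.mem_range.1 hi)]
      rw [norm_mul, norm_pow, Complex.norm_real, Real.norm_of_nonneg hr0]
      ring
    · by_contra hcon
      have := hcoeff i
      rw [if_neg (by simpa using hcon)] at this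
      exact (Polynomial.mem_support_iff.1 hi) this
    · rw [Polynomial.notMem_support_iff.1 hi]; simp
  simp only [hpars]
  refine Filter.Tendsto.const_mul _ ?_
  refine intervalIntegral.tendsto_integral_filter_of_dominated_convergence
    (fun _ => (∑' n, ‖c n‖ * r ^ n) ^ 2) ?_ ?_ ?_ ?_
  · refine Filter.Eventually.of_forall fun N => Continuous.aestronglyMeasurable ?_
    simp only [hP]
    have := continuous_circleMap (0 : ℂ) r
    fun_prop
  · refine Filter.Eventually.of_forall fun N => Filter.Eventually.of_forall fun θ _ => ?_
    rw [Real.norm_of_nonneg (by positivity)]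
    refine pow_le_pow_left₀ (norm_nonneg _) ?_ 2
    refine (norm_sum_le _ _).trans ?_
    simp only [hnorm]
    exact hsum.sum_le_tsum _ fun n _ => by positivity
  · exact intervalIntegrable_const
  · refine Filter.Eventually.of_forall fun θ _ => ?_
    exact (((hf _ (hmem θ)).tendsto_sum_nat).norm).pow 2

/-- The area integral of the square of the modulus of a power series over the unit disk. -/
theorem lintegral_ball_norm_sq_eq_tsum {f : ℂ → ℂ} {c : ℕ → ℂ}
    (hfd : DifferentiableOn ℂ f (ball (0 : ℂ) 1))
    (hf : ∀ z ∈ ball (0 : ℂ) 1, HasSum (fun n => c n * z ^ n) (f z)) :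
    ∫⁻ z in ball (0 : ℂ) 1, ENNReal.ofReal (‖f z‖ ^ 2) =
      ENNReal.ofReal π * ∑' n : ℕ, ENNReal.ofReal (‖c n‖ ^ 2 / ((n : ℝ) + 1)) := by
  set G : ℂ → ENNReal := (ball (0 : ℂ) 1).indicator fun z => ENNReal.ofReal (‖f z‖ ^ 2) with hG
  have hGm : Measurable G := by
    classical
    rw [hG, ← Set.piecewise_eq_indicator]
    refine ContinuousOn.measurable_piecewise ?_ continuousOn_const measurableSet_ball
    exact ENNReal.continuous_ofReal.comp_continuousOn (hfd.continuousOn.norm.pow 2)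
  rw [← lintegral_indicator measurableSet_ball, ← Complex.lintegral_comp_polarCoord_symm,
    show polarCoord.target = Set.Ioi (0 : ℝ) ×ˢ Set.Ioo (-π) π from rfl, Measure.volume_eq_prod, ← hG]
  have hcirc : ∀ p : ℝ × ℝ, Complex.polarCoord.symm p = circleMap 0 p.1 p.2 := fun p => by
    rw [Complex.polarCoord_symm_apply, circleMap, Complex.exp_mul_I]; simp
  have hcont : Continuous fun p : ℝ × ℝ => circleMap 0 p.1 p.2 := by
    unfold circleMap; fun_prop
  simp only [hcirc]
  rw [setLIntegral_prod _ (by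
    refine Measurable.aemeasurable ?_
    simp only [smul_eq_mul]
    exact (ENNReal.measurable_ofReal.comp measurable_fst).mul (hGm.comp hcont.measurable))]
  have hinner : ∀ r ∈ Set.Ioi (0 : ℝ),
      ∫⁻ θ in Set.Ioo (-π) π, ENNReal.ofReal r • G (circleMap 0 r θ) =
        (Set.Ioo (0 : ℝ) 1).indicator
          (fun r => ∑' n : ℕ, ENNReal.ofReal (2 * π * ‖c n‖ ^ 2 * r ^ (2 * n + 1))) r := by
    intro r hr
    have hr0 : (0 : ℝ) < r := hr
    by_cases hr1 : r < 1
    · have hmem : ∀ θ, circleMap 0 r θ ∈ ball (0 : ℂ) 1 := fun θ => by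
        simp [abs_of_pos hr0, hr1]
      rw [Set.indicator_of_mem (show r ∈ Set.Ioo (0 : ℝ) 1 from ⟨hr0, hr1⟩)]
      have hGe : ∀ θ, ENNReal.ofReal r • G (circleMap 0 r θ) =
          ENNReal.ofReal (r * ‖f (circleMap 0 r θ)‖ ^ 2) := fun θ => by
        rw [hG, Set.indicator_of_mem (hmem θ), smul_eq_mul, ENNReal.ofReal_mul hr0.le]
      simp only [hGe]
      have hfc : Continuous fun θ => ‖f (circleMap 0 r θ)‖ ^ 2 :=
        ((hfd.continuousOn.comp_continuous (continuous_circleMap 0 r) hmem).norm).pow 2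
      have hper : Function.Periodic (fun θ => ‖f (circleMap 0 r θ)‖ ^ 2) (2 * π) := fun θ => by
        simp only [periodic_circleMap 0 r θ]
      have hpars := hasSum_norm_sq_coeff_mul_pow hf hr0.le hr1
      have h_int : ∫ θ in Set.Ioo (-π) π, r * ‖f (circleMap 0 r θ)‖ ^ 2 =
          ∑' n : ℕ, 2 * π * ‖c n‖ ^ 2 * r ^ (2 * n + 1) := by
        rw [← integral_Ioc_eq_integral_Ioo, ← intervalIntegral.integral_of_le (by linarith [pi_pos]),
          intervalIntegral.integral_const_mul]
        have h3 := hper.intervalIntegral_add_eq (-π) 0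
        rw [show -π + 2 * π = π by ring, zero_add] at h3
        rw [h3]
        have h4 := (hpars.mul_left (2 * π * r)).tsum_eq
        have hpi : (2 * π) ≠ 0 := by positivity
        rw [show r * (∫ θ in (0 : ℝ)..2 * π, ‖f (circleMap 0 r θ)‖ ^ 2) = 2 * π * r *
          ((2 * π)⁻¹ * ∫ θ in (0 : ℝ)..2 * π, ‖f (circleMap 0 r θ)‖ ^ 2) by field_simp, ← h4]
        refine tsum_congr fun n => ?_
        ring
      rw [← ofReal_integral_eq_lintegral_ofReal, h_int, ENNReal.ofReal_tsum_of_nonneg]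
      · intro n; positivity
      · refine (hpars.mul_left (2 * π * r)).summable.congr fun n => ?_
        ring
      · exact ((continuous_const.mul hfc).integrableOn_Icc (a := -π) (b := π)).mono_set
          Set.Ioo_subset_Icc_self
      · exact Filter.Eventually.of_forall fun θ => by positivity
    · rw [Set.indicator_of_notMem (fun h : r ∈ Set.Ioo (0 : ℝ) 1 => hr1 h.2)]
      have : ∀ θ, G (circleMap 0 r θ) = 0 := fun θ => by
        rw [hG, Set.indicator_of_notMem]
        simpa [abs_of_pos hr0] using hr1
      simp [this]
  rw [setLIntegral_congr_fun measurableSet_Ioi hinner, lintegral_indicator measurableSet_Ioo,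
    Measure.restrict_restrict measurableSet_Ioo,
    Set.inter_eq_left.2 (fun x hx => hx.1), lintegral_tsum (fun n => by fun_prop),
    ← ENNReal.tsum_mul_left]
  refine tsum_congr fun n => ?_
  rw [← ofReal_integral_eq_lintegral_ofReal, ← integral_Ioc_eq_integral_Ioo,
    ← intervalIntegral.integral_of_le zero_le_one, intervalIntegral.integral_const_mul,
    integral_pow, ← ENNReal.ofReal_mul pi_pos.le]
  · congr 1
    have : (n : ℝ) + 1 ≠ 0 := by positivity
    have h2 : (2 * (n : ℝ) + 1 + 1) ≠ 0 := by positivity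
    push_cast
    simp only [one_pow, zero_pow (Nat.succ_ne_zero _), sub_zero]
    field_simp
    ring
  · exact (Continuous.integrableOn_Icc (by fun_prop)).mono_set Set.Ioo_subset_Icc_self
  · filter_upwards [ae_restrict_mem measurableSet_Ioo] with x hx
    have := hx.1.le
    simp only [Pi.zero_apply]
    positivity

theorem hasSum_taylor_unit_ball {f : ℂ → ℂ} (hf : DifferentiableOn ℂ f (ball (0 : ℂ) 1))
    {z : ℂ} (hz : z ∈ ball (0 : ℂ) 1) :
    HasSum (fun n : ℕ => ((n.factorial : ℂ)⁻¹ * iteratedDeriv n f 0) * z ^ n) (f z) := by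
  have h := Complex.hasSum_taylorSeries_on_ball hf hz
  refine h.congr_fun ?_
  intro n
  simp only [sub_zero, smul_eq_mul]
  ring

/-- The exponential of a function with finite Dirichlet integral lies in the Hardy space `H²`. -/
theorem exists_hasSum_exp_of_dirichlet {T : ℂ → ℂ}
    (hT : DifferentiableOn ℂ T (ball (0 : ℂ) 1)) (hT0 : T 0 = 0) {δ : ℝ} (hδ : 0 ≤ δ)
    (hD : ∫⁻ z in ball (0 : ℂ) 1, ENNReal.ofReal (‖deriv T z‖ ^ 2) ≤ ENNReal.ofReal (π * δ)) :
    ∃ b : ℕ → ℂ, b 0 = 1 ∧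
      (∀ n, b n = (n.factorial : ℂ)⁻¹ * iteratedDeriv n (fun z => Complex.exp (T z)) 0) ∧
      (∀ z ∈ ball (0 : ℂ) 1, HasSum (fun n => b n * z ^ n) (Complex.exp (T z))) ∧
      Summable (fun n => ‖b n‖ ^ 2) ∧ ∑' n, ‖b n‖ ^ 2 ≤ Real.exp δ := by
  set H : ℂ → ℂ := fun z => Complex.exp (T z) with hH
  have hHd : DifferentiableOn ℂ H (ball (0 : ℂ) 1) := hT.cexp
  have hT'd : DifferentiableOn ℂ (deriv T) (ball (0 : ℂ) 1) := hT.deriv isOpen_ball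
  set b : ℕ → ℂ := fun n => (n.factorial : ℂ)⁻¹ * iteratedDeriv n H 0 with hb
  set d : ℕ → ℂ := fun n => (n.factorial : ℂ)⁻¹ * iteratedDeriv n (deriv T) 0 with hd
  have h0 : (0 : ℂ) ∈ ball (0 : ℂ) 1 := mem_ball_self one_pos
  have hnhds : ball (0 : ℂ) 1 ∈ nhds (0 : ℂ) := ball_mem_nhds _ one_pos
  have hb0 : b 0 = 1 := by simp [hb, hH, hT0]
  have hrec : ∀ n : ℕ, ((n : ℂ) + 1) * b (n + 1) =
      ∑ k ∈ Finset.range (n + 1), d k * b (n - k) := by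
    intro n
    have hder : deriv H =ᶠ[nhds 0] fun z => deriv T z * H z := by
      filter_upwards [hnhds] with z hz
      have := ((hT.differentiableAt (isOpen_ball.mem_nhds hz)).hasDerivAt.cexp).deriv
      rw [hH]
      simp only [this]
      ring
    have h1 : iteratedDeriv (n + 1) H 0 = ∑ i ∈ Finset.range (n + 1),
        (n.choose i : ℂ) * iteratedDeriv i (deriv T) 0 * iteratedDeriv (n - i) H 0 := by
      rw [iteratedDeriv_succ', hder.iteratedDeriv_eq, iteratedDeriv_fun_mul]
      · exact (hT'd.analyticAt hnhds).contDiffAt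
      · exact (hHd.analyticAt hnhds).contDiffAt
    have hfac : ((n : ℂ) + 1) * ((n + 1).factorial : ℂ)⁻¹ = (n.factorial : ℂ)⁻¹ := by
      have : ((n : ℂ) + 1) ≠ 0 := by exact_mod_cast Nat.succ_ne_zero n
      rw [Nat.factorial_succ]
      push_cast
      field_simp
    simp only [hb, hd]
    rw [← mul_assoc, hfac, h1, Finset.mul_sum]
    refine Finset.sum_congr rfl fun i hi => ?_
    have hin : i ≤ n := Nat.lt_succ_iff.mp (Finset.mem_range.mp hi)
    have hc : (n.factorial : ℂ)⁻¹ * (n.choose i : ℂ) =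
        (i.factorial : ℂ)⁻¹ * ((n - i).factorial : ℂ)⁻¹ := by
      rw [Nat.cast_choose ℂ hin]
      have := Nat.cast_ne_zero (R := ℂ).2 n.factorial_ne_zero
      field_simp
    rw [← mul_assoc, ← mul_assoc, hc]
    ring
  have hbound : ∀ N, ∑ n ∈ Finset.range N, ‖b n‖ ^ 2 ≤ Real.exp δ := by
    intro N
    refine (Finset.sum_le_sum_of_subset_of_nonneg (Finset.range_mono (Nat.le_succ N))
      fun _ _ _ => by positivity).trans ((lebedev_milin d b hb0 hrec N).trans ?_)
    refine Real.exp_le_exp.2 ?_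
    have h2 := lintegral_ball_norm_sq_eq_tsum hT'd (fun z hz => hasSum_taylor_unit_ball hT'd hz)
    rw [h2, ENNReal.ofReal_mul pi_pos.le, ENNReal.mul_le_mul_iff_right
      (by simpa using pi_pos) ENNReal.ofReal_ne_top] at hD
    have h3 := (ENNReal.sum_le_tsum (Finset.range N)).trans hD
    rw [← ENNReal.ofReal_sum_of_nonneg (fun _ _ => by positivity),
      ENNReal.ofReal_le_ofReal_iff hδ] at h3
    exact h3
  refine ⟨b, hb0, fun _ => rfl, fun z hz => hasSum_taylor_unit_ball hHd hz, ?_, ?_⟩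
  · exact summable_of_sum_range_le (fun _ => by positivity) hbound
  · exact Real.tsum_le_of_sum_range_le (fun _ => by positivity) hbound

/-- A function with small Dirichlet integral is close to a constant, exponentially and in mean
square on circles. -/
theorem integral_norm_exp_sub_one_sq_le {T : ℂ → ℂ}
    (hT : DifferentiableOn ℂ T (ball (0 : ℂ) 1)) (hT0 : T 0 = 0) {δ : ℝ} (hδ : 0 ≤ δ)
    (hD : ∫⁻ z in ball (0 : ℂ) 1, ENNReal.ofReal (‖deriv T z‖ ^ 2) ≤ ENNReal.ofReal (π * δ))
    {r : ℝ} (hr0 : 0 ≤ r) (hr1 : r < 1) :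
    ∫ θ in (0 : ℝ)..2 * π, ‖Complex.exp (T (circleMap 0 r θ)) - 1‖ ^ 2 ≤
      2 * π * (Real.exp δ - 1) := by
  obtain ⟨b, hb0, -, hb, hbs, hbt⟩ := exists_hasSum_exp_of_dirichlet hT hT0 hδ hD
  set c : ℕ → ℂ := fun n => if n = 0 then 0 else b n with hc
  have hcs : ∀ z ∈ ball (0 : ℂ) 1, HasSum (fun n => c n * z ^ n) (Complex.exp (T z) - 1) := by
    intro z hz
    have h1 : HasSum (fun n : ℕ => if n = 0 then (1 : ℂ) else 0) 1 := hasSum_ite_eq 0 1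
    refine ((hb z hz).sub h1).congr_fun fun n => ?_
    by_cases hn : n = 0
    · simp [hc, hn, hb0]
    · simp [hc, hn]
  have hP := hasSum_norm_sq_coeff_mul_pow hcs hr0 hr1
  have hs1 : HasSum (fun n : ℕ => if n = 0 then (1 : ℝ) else 0) 1 := hasSum_ite_eq 0 1
  have h2 := hasSum_le (fun n => ?_) hP (hbs.hasSum.sub hs1)
  · have h3 : (2 * π)⁻¹ * ∫ θ in (0 : ℝ)..2 * π, ‖Complex.exp (T (circleMap 0 r θ)) - 1‖ ^ 2 ≤
        Real.exp δ - 1 := h2.trans (by linarith)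
    rwa [inv_mul_le_iff₀ (by positivity)] at h3
  · by_cases hn : n = 0
    · simp [hc, hn, hb0]
    · simp only [hc, if_neg hn, sub_zero]
      exact mul_le_of_le_one_right (by positivity) (pow_le_one₀ hr0 hr1.le)

/-- A function of the form `(z - z₀) ^ n * h z` with `h z₀ ≠ 0` has a local `n`-th root. -/
theorem exists_local_root {h : ℂ → ℂ} {z₀ : ℂ} (hh : AnalyticAt ℂ h z₀) (h0 : h z₀ ≠ 0) {n : ℕ}
    (hn : n ≠ 0) : ∃ k : ℂ → ℂ, ∃ c : ℂ, c ≠ 0 ∧ k z₀ = 0 ∧ HasStrictDerivAt k c z₀ ∧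
      ∀ z, h z ≠ 0 → k z ^ n = (z - z₀) ^ n * h z := by
  have hnC : (n : ℂ) ≠ 0 := Nat.cast_ne_zero.2 hn
  set u : ℂ → ℂ := fun z => Complex.exp ((Complex.log (h z / h z₀) + Complex.log (h z₀)) / n)
    with hu
  have hua : AnalyticAt ℂ u z₀ := by
    have h1 : AnalyticAt ℂ (fun z => h z / h z₀) z₀ := hh.div analyticAt_const h0
    have h2 : AnalyticAt ℂ (fun z => Complex.log (h z / h z₀)) z₀ := by
      refine h1.clog ?_
      rw [div_self h0]
      exact Complex.one_mem_slitPlane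
    exact ((h2.add analyticAt_const).div analyticAt_const hnC).cexp
  refine ⟨fun z => (z - z₀) * u z, u z₀, Complex.exp_ne_zero _, by simp, ?_, fun z hz => ?_⟩
  · have h1 : HasStrictDerivAt (fun z : ℂ => z - z₀) 1 z₀ := (hasStrictDerivAt_id z₀).sub_const z₀
    have h2 := h1.fun_mul hua.hasStrictDerivAt
    simpa using h2
  · simp only [mul_pow, hu]
    rw [← Complex.exp_nat_mul, mul_div_cancel₀ _ hnC, Complex.exp_add,
      Complex.exp_log (div_ne_zero hz h0), Complex.exp_log h0, div_mul_cancel₀ _ h0]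

theorem deriv_ne_zero_of_injOn {F : ℂ → ℂ} {U : Set ℂ} (hU : IsOpen U)
    (hF : DifferentiableOn ℂ F U) (hinj : Set.InjOn F U) {z₀ : ℂ} (hz₀ : z₀ ∈ U) :
    deriv F z₀ ≠ 0 := by
  intro hd
  have hUn : U ∈ nhds z₀ := hU.mem_nhds hz₀
  have hFa : AnalyticAt ℂ F z₀ := hF.analyticAt hUn
  have hGa : AnalyticAt ℂ (fun z => F z - F z₀) z₀ := hFa.sub analyticAt_const
  obtain ⟨n, hn⟩ : ∃ n : ℕ, analyticOrderAt (fun z => F z - F z₀) z₀ = n := by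
    refine ⟨_, (ENat.natCast_toNat ?_).symm⟩
    intro htop
    rw [analyticOrderAt_eq_top] at htop
    have h1 : ∀ᶠ z in nhds z₀, z = z₀ := by
      filter_upwards [htop, hUn] with z hz hzU
      exact hinj hzU hz₀ (sub_eq_zero.1 hz)
    have h2 := h1.filter_mono (nhdsWithin_le_nhds (s := {z₀}ᶜ))
    obtain ⟨z, hz, hz'⟩ := (h2.and self_mem_nhdsWithin).exists
    exact hz' hz
  obtain ⟨h, hha, hh0, hhe⟩ := (hGa.analyticOrderAt_eq_natCast).1 hn
  have hn0 : n ≠ 0 := by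
    rintro rfl
    have := hhe.self_of_nhds
    simp at this
    exact hh0 this.symm
  have hn1 : n ≠ 1 := by
    rintro rfl
    have h1 : HasDerivAt (fun z => (z - z₀) ^ 1 • h z) (h z₀) z₀ := by
      have := ((hasDerivAt_id z₀).sub_const z₀).fun_mul hha.differentiableAt.hasDerivAt
      simpa using this
    have h2 : HasDerivAt (fun z => F z - F z₀) (h z₀) z₀ := h1.congr_of_eventuallyEq hhe
    have h3 := (hFa.differentiableAt.hasDerivAt.sub_const (F z₀)).unique h2
    exact hh0 (by rw [← h3, hd])
  obtain ⟨k, c, hc, hk0, hk, hkp⟩ := exists_local_root hha hh0 hn0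
  have hgood : ∀ᶠ z in nhds z₀, z ∈ U ∧ F z - F z₀ = (z - z₀) ^ n * h z ∧ h z ≠ 0 := by
    filter_upwards [hUn, hhe, hha.continuousAt.eventually_ne hh0] with z h1 h2 h3
    exact ⟨h1, h2, h3⟩
  have himg : k '' {z | z ∈ U ∧ F z - F z₀ = (z - z₀) ^ n * h z ∧ h z ≠ 0} ∈ nhds (0 : ℂ) := by
    have := Filter.image_mem_map (m := k) hgood
    rwa [hk.map_nhds_eq hc, hk0] at this
  obtain ⟨ε, hε, hball⟩ := Metric.mem_nhds_iff.1 himg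
  set ζ : ℂ := Complex.exp (2 * π * Complex.I / n) with hζ
  have hprim : IsPrimitiveRoot ζ n := Complex.isPrimitiveRoot_exp n hn0
  have hζ1 : ζ ≠ 1 := hprim.ne_one (by omega)
  have hζn : ‖ζ‖ = 1 := hprim.norm'_eq_one hn0
  obtain ⟨z1, ⟨hz1U, hz1, hz1h⟩, hkz1⟩ := hball (show ((ε / 2 : ℝ) : ℂ) ∈ ball 0 ε by
    rw [mem_ball_zero_iff, Complex.norm_real, Real.norm_of_nonneg (half_pos hε).le]
    exact half_lt_self hε)
  obtain ⟨z2, ⟨hz2U, hz2, hz2h⟩, hkz2⟩ := hball (show ζ * ((ε / 2 : ℝ) : ℂ) ∈ ball 0 ε by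
    rw [mem_ball_zero_iff, norm_mul, hζn, one_mul, Complex.norm_real, Real.norm_of_nonneg
      (half_pos hε).le]
    exact half_lt_self hε)
  have hFe : F z1 = F z2 := by
    have : F z1 - F z₀ = F z2 - F z₀ := by
      rw [hz1, hz2, ← hkp z1 hz1h, ← hkp z2 hz2h, hkz1, hkz2, mul_pow, hprim.pow_eq_one, one_mul]
    linear_combination this
  have : z1 = z2 := hinj hz1U hz2U hFe
  rw [this, hkz2] at hkz1
  have hε' : ((ε / 2 : ℝ) : ℂ) ≠ 0 := by exact_mod_cast (half_pos hε).ne'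
  exact hζ1 (mul_right_cancel₀ hε' (by rw [hkz1, one_mul]))

/-- An injective holomorphic function on the disk has a logarithm of its derivative. -/
theorem exists_log_deriv {F : ℂ → ℂ} (hF : DifferentiableOn ℂ F (ball (0 : ℂ) 1))
    (hinj : Set.InjOn F (ball (0 : ℂ) 1)) :
    ∃ g : ℂ → ℂ, DifferentiableOn ℂ g (ball (0 : ℂ) 1) ∧
      (∀ z ∈ ball (0 : ℂ) 1, deriv F z = Complex.exp (g z)) ∧
      ∀ z ∈ ball (0 : ℂ) 1, deriv g z = deriv (deriv F) z / deriv F z := by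
  have h0 : (0 : ℂ) ∈ ball (0 : ℂ) 1 := mem_ball_self one_pos
  have hne : ∀ z ∈ ball (0 : ℂ) 1, deriv F z ≠ 0 := fun z hz =>
    deriv_ne_zero_of_injOn isOpen_ball hF hinj hz
  have hF' : DifferentiableOn ℂ (deriv F) (ball (0 : ℂ) 1) := hF.deriv isOpen_ball
  have hF'' : DifferentiableOn ℂ (deriv (deriv F)) (ball (0 : ℂ) 1) := hF'.deriv isOpen_ball
  have hq : DifferentiableOn ℂ (fun z => deriv (deriv F) z / deriv F z) (ball (0 : ℂ) 1) :=
    hF''.div hF' hne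
  obtain ⟨g, hg0, hg⟩ := hq.isExactOn_ball.with_val_at 0 (Complex.log (deriv F 0))
  have hgd : DifferentiableOn ℂ g (ball (0 : ℂ) 1) := fun z hz =>
    (hg z hz).differentiableAt.differentiableWithinAt
  refine ⟨g, hgd, fun z hz => ?_, fun z hz => (hg z hz).deriv⟩
  have hconst : Set.EqOn (fun z => deriv F z * Complex.exp (-g z)) (fun _ => 1)
      (ball (0 : ℂ) 1) := by
    have hder : ∀ z ∈ ball (0 : ℂ) 1,
        HasDerivAt (fun z => deriv F z * Complex.exp (-g z)) 0 z := by
      intro z hz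
      have h1 := (hF'.differentiableAt (isOpen_ball.mem_nhds hz)).hasDerivAt.mul
        (hg z hz).neg.cexp
      refine h1.congr_deriv ?_
      rw [mul_neg, mul_neg, ← mul_assoc, mul_comm (deriv F z), mul_assoc,
        mul_div_cancel₀ _ (hne z hz)]
      ring
    intro z hz
    have hd : DifferentiableOn ℂ (fun z => deriv F z * Complex.exp (-g z)) (ball (0 : ℂ) 1) :=
      fun z hz => (hder z hz).differentiableAt.differentiableWithinAt
    have := isOpen_ball.is_const_of_deriv_eq_zero (convex_ball (0 : ℂ) 1).isPreconnected hd
      (fun z hz => (hder z hz).deriv) hz h0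
    refine this.trans ?_
    rw [hg0, Complex.exp_neg, Complex.exp_log (hne 0 h0), mul_inv_cancel₀ (hne 0 h0)]
  have := hconst hz
  simp only [Complex.exp_neg] at this
  field_simp at this
  exact this

/-- A function with finite Dirichlet integral is the sum of a polynomial, here recorded only
through its Lipschitz continuity, and of a function with small Dirichlet integral. -/
theorem exists_lipschitz_sub_small_dirichlet {g : ℂ → ℂ}
    (hg : DifferentiableOn ℂ g (ball (0 : ℂ) 1))
    (hD : ∫⁻ z in ball (0 : ℂ) 1, ENNReal.ofReal (‖deriv g z‖ ^ 2) < ⊤) {δ : ℝ} (hδ : 0 < δ) :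
    ∃ P : ℂ → ℂ, ∃ K : ℝ, 0 ≤ K ∧
      (∀ z ∈ ball (0 : ℂ) 1, ∀ w ∈ ball (0 : ℂ) 1, ‖P z - P w‖ ≤ K * ‖z - w‖) ∧
      DifferentiableOn ℂ (fun z => g z - P z) (ball (0 : ℂ) 1) ∧
      ∫⁻ z in ball (0 : ℂ) 1, ENNReal.ofReal (‖deriv (fun z => g z - P z) z‖ ^ 2) ≤
        ENNReal.ofReal (π * δ) := by
  have hg' : DifferentiableOn ℂ (deriv g) (ball (0 : ℂ) 1) := hg.deriv isOpen_ball
  set c : ℕ → ℂ := fun n => (n.factorial : ℂ)⁻¹ * iteratedDeriv n (deriv g) 0 with hc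
  have hcs : ∀ z ∈ ball (0 : ℂ) 1, HasSum (fun n => c n * z ^ n) (deriv g z) :=
    fun z hz => hasSum_taylor_unit_ball hg' hz
  set e : ℕ → ENNReal := fun n => ENNReal.ofReal (‖c n‖ ^ 2 / ((n : ℝ) + 1)) with he
  have hetop : ∑' n, e n ≠ ⊤ := by
    rw [lintegral_ball_norm_sq_eq_tsum hg' hcs] at hD
    intro h
    rw [h, ENNReal.mul_top (by simpa using pi_pos)] at hD
    exact lt_irrefl _ hD
  obtain ⟨N, hN⟩ := ((ENNReal.tendsto_sum_nat_add e hetop).eventually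
    (gt_mem_nhds (ENNReal.ofReal_pos.2 hδ))).exists
  set P : ℂ → ℂ := fun z => ∑ k ∈ Finset.range N, c k / ((k : ℂ) + 1) * z ^ (k + 1) with hP
  have hPd : ∀ z, HasDerivAt P (∑ k ∈ Finset.range N, c k * z ^ k) z := by
    intro z
    refine HasDerivAt.fun_sum fun k _ => ?_
    refine ((hasDerivAt_pow (k + 1) z).const_mul (c k / ((k : ℂ) + 1))).congr_deriv ?_
    have : ((k : ℂ) + 1) ≠ 0 := by exact_mod_cast Nat.succ_ne_zero k
    push_cast
    field_simp
  have htd : DifferentiableOn ℂ (fun z => g z - P z) (ball (0 : ℂ) 1) :=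
    hg.sub fun z _ => (hPd z).differentiableAt.differentiableWithinAt
  refine ⟨P, ∑ k ∈ Finset.range N, ‖c k‖, Finset.sum_nonneg fun _ _ => norm_nonneg _, ?_, htd, ?_⟩
  · intro z hz w hw
    refine (convex_ball (0 : ℂ) 1).norm_image_sub_le_of_norm_hasDerivWithin_le
      (fun x _ => (hPd x).hasDerivWithinAt) (fun x hx => ?_) hw hz
    refine (norm_sum_le _ _).trans (Finset.sum_le_sum fun k _ => ?_)
    rw [norm_mul, norm_pow]
    exact mul_le_of_le_one_right (norm_nonneg _)
      (pow_le_one₀ (norm_nonneg _) (mem_ball_zero_iff.1 hx).le)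
  · set c' : ℕ → ℂ := fun n => if n < N then 0 else c n with hc'
    have hc's : ∀ z ∈ ball (0 : ℂ) 1,
        HasSum (fun n => c' n * z ^ n) (deriv (fun z => g z - P z) z) := by
      intro z hz
      have h1 : deriv (fun z => g z - P z) z = deriv g z - ∑ k ∈ Finset.range N, c k * z ^ k :=
        ((hg.differentiableAt (isOpen_ball.mem_nhds hz)).hasDerivAt.sub (hPd z)).deriv
      have h2 : HasSum (fun n => if n < N then c n * z ^ n else 0)
          (∑ k ∈ Finset.range N, c k * z ^ k) := by
        have := hasSum_sum_of_ne_finset_zero (L := SummationFilter.unconditional ℕ) (f := fun n => if n < N then c n * z ^ n else 0)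
          (s := Finset.range N) (fun n hn => if_neg (by simpa using hn))
        rwa [Finset.sum_congr rfl (fun k hk => if_pos (Finset.mem_range.1 hk))] at this
      rw [h1]
      refine ((hcs z hz).sub h2).congr_fun fun n => ?_
      by_cases hn : n < N <;> simp [hc', hn]
    rw [lintegral_ball_norm_sq_eq_tsum (htd.deriv isOpen_ball) hc's, ENNReal.ofReal_mul pi_pos.le]
    gcongr
    refine le_trans (le_of_eq ?_) hN.le
    rw [← ENNReal.summable.sum_add_tsum_nat_add' (k := N), Finset.sum_eq_zero, zero_add]
    · refine tsum_congr fun n => ?_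
      simp [hc', he]
    · intro k hk
      simp [hc', Finset.mem_range.1 hk]

/-- The Dirichlet integral does not increase under composition with injective self-maps of the
disk. -/
theorem lintegral_norm_deriv_comp_le {t χ : ℂ → ℂ} (ht : DifferentiableOn ℂ t (ball (0 : ℂ) 1))
    (hχ : DifferentiableOn ℂ χ (ball (0 : ℂ) 1))
    (hm : Set.MapsTo χ (ball (0 : ℂ) 1) (ball (0 : ℂ) 1)) (hi : Set.InjOn χ (ball (0 : ℂ) 1)) :
    ∫⁻ z in ball (0 : ℂ) 1, ENNReal.ofReal (‖deriv (fun z => t (χ z)) z‖ ^ 2) ≤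
      ∫⁻ z in ball (0 : ℂ) 1, ENNReal.ofReal (‖deriv t z‖ ^ 2) := by
  have hder : ∀ z ∈ ball (0 : ℂ) 1, HasDerivAt χ (deriv χ z) z := fun z hz =>
    (hχ.differentiableAt (isOpen_ball.mem_nhds hz)).hasDerivAt
  have hfd : ∀ z ∈ ball (0 : ℂ) 1, HasFDerivWithinAt χ
      ((ContinuousLinearMap.toSpanSingleton ℂ (deriv χ z)).restrictScalars ℝ)
      (ball (0 : ℂ) 1) z := fun z hz =>
    ((hder z hz).hasFDerivAt.restrictScalars ℝ).hasFDerivWithinAt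
  have h1 := lintegral_image_eq_lintegral_abs_det_fderiv_mul volume measurableSet_ball hfd hi
    (fun w => ENNReal.ofReal (‖deriv t w‖ ^ 2))
  refine le_trans (le_of_eq ?_) (lintegral_mono_set (μ := volume) hm.image_subset)
  rw [h1]
  refine setLIntegral_congr_fun measurableSet_ball fun z hz => ?_
  have hdet : ((ContinuousLinearMap.toSpanSingleton ℂ (deriv χ z)).restrictScalars ℝ).det =
      ‖deriv χ z‖ ^ 2 := by
    simp [ContinuousLinearMap.det, LinearMap.det_restrictScalars, Algebra.norm_complex_eq,
      Complex.normSq_eq_norm_sq]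
  have hcomp : deriv (fun z => t (χ z)) z = deriv t (χ z) * deriv χ z :=
    ((ht.differentiableAt (isOpen_ball.mem_nhds (hm hz))).hasDerivAt.comp z (hder z hz)).deriv
  simp only [hdet, hcomp]
  rw [← ENNReal.ofReal_mul (abs_nonneg _), abs_of_nonneg (by positivity), norm_mul]
  congr 1
  ring

theorem integral_norm_exp_sub_one_sq_le_of_continuousOn {T : ℂ → ℂ}
    (hT : DifferentiableOn ℂ T (ball (0 : ℂ) 1)) (hTc : ContinuousOn T (closedBall (0 : ℂ) 1))
    (hT0 : T 0 = 0) {δ : ℝ} (hδ : 0 ≤ δ)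
    (hD : ∫⁻ z in ball (0 : ℂ) 1, ENNReal.ofReal (‖deriv T z‖ ^ 2) ≤
      ENNReal.ofReal (π * δ)) :
    ∫ θ in (0 : ℝ)..2 * π, ‖Complex.exp (T (circleMap 0 1 θ)) - 1‖ ^ 2 ≤
      2 * π * (Real.exp δ - 1) := by
  set G : ℂ → ℝ := fun z => ‖Complex.exp (T z) - 1‖ ^ 2 with hG
  have hGc : ContinuousOn G (closedBall (0 : ℂ) 1) := by
    simp only [hG]
    fun_prop
  obtain ⟨B, hB⟩ := (isCompact_closedBall (0 : ℂ) 1).exists_bound_of_continuousOn hGc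
  have hmem : ∀ r ∈ Set.Ioo (0 : ℝ) 1, ∀ θ, circleMap 0 r θ ∈ closedBall (0 : ℂ) 1 := by
    intro r hr θ
    simp [abs_of_pos hr.1, hr.2.le]
  have hmem1 : ∀ θ, circleMap 0 1 θ ∈ closedBall (0 : ℂ) 1 := fun θ => by simp
  have hIoo : ∀ᶠ r in nhdsWithin (1 : ℝ) (Set.Iio 1), r ∈ Set.Ioo (0 : ℝ) 1 :=
    Ioo_mem_nhdsLT one_pos
  have hlim : Filter.Tendsto (fun r => ∫ θ in (0 : ℝ)..2 * π, G (circleMap 0 r θ))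
      (nhdsWithin (1 : ℝ) (Set.Iio 1)) (nhds (∫ θ in (0 : ℝ)..2 * π, G (circleMap 0 1 θ))) := by
    refine intervalIntegral.tendsto_integral_filter_of_dominated_convergence (fun _ => B) ?_ ?_
      intervalIntegrable_const ?_
    · filter_upwards [hIoo] with r hr
      exact (hGc.comp_continuous (continuous_circleMap 0 r) (hmem r hr)).aestronglyMeasurable
    · filter_upwards [hIoo] with r hr
      exact Filter.Eventually.of_forall fun θ _ => hB _ (hmem r hr θ)
    · refine Filter.Eventually.of_forall fun θ _ => ?_
      refine (hGc _ (hmem1 θ)).tendsto.comp (tendsto_nhdsWithin_iff.2 ⟨?_, ?_⟩)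
      · have : Continuous fun r : ℝ => circleMap 0 r θ := by
          unfold circleMap
          fun_prop
        exact (this.tendsto 1).mono_left nhdsWithin_le_nhds
      · filter_upwards [hIoo] with r hr using hmem r hr θ
  refine le_of_tendsto hlim ?_
  filter_upwards [hIoo] with r hr
  exact integral_norm_exp_sub_one_sq_le hT hT0 hδ hD hr.1.le hr.2

section Mobius

variable {a : ℝ}

theorem one_add_ofReal_mul_ne_zero (ha0 : 0 ≤ a) (ha1 : a < 1) {z : ℂ} (hz : ‖z‖ ≤ 1) :
    1 + (a : ℂ) * z ≠ 0 := by
  intro h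
  have h1 : (a : ℂ) * z = -1 := by linear_combination h
  have h2 : a * ‖z‖ = 1 := by
    have := congrArg norm h1
    rwa [norm_mul, Complex.norm_real, Real.norm_of_nonneg ha0, norm_neg, norm_one] at this
  nlinarith [norm_nonneg z]

theorem norm_sq_one_add_sub_norm_sq (z : ℂ) :
    ‖1 + (a : ℂ) * z‖ ^ 2 - ‖z + a‖ ^ 2 = (1 - a ^ 2) * (1 - ‖z‖ ^ 2) := by
  simp only [← Complex.normSq_eq_norm_sq, Complex.normSq_apply, Complex.add_re, Complex.add_im,
    Complex.mul_re, Complex.mul_im, Complex.ofReal_re, Complex.ofReal_im, Complex.one_re,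
    Complex.one_im]
  ring

theorem norm_mobius_lt_one (ha0 : 0 ≤ a) (ha1 : a < 1) {z : ℂ} (hz : ‖z‖ < 1) :
    ‖(z + a) / (1 + (a : ℂ) * z)‖ < 1 := by
  have h0 := norm_pos_iff.2 (one_add_ofReal_mul_ne_zero ha0 ha1 hz.le)
  rw [norm_div, div_lt_one h0]
  refine lt_of_pow_lt_pow_left₀ 2 h0.le ?_
  have h1 := norm_sq_one_add_sub_norm_sq (a := a) z
  have h2 : 0 < (1 - a ^ 2) * (1 - ‖z‖ ^ 2) :=
    mul_pos (by nlinarith) (by nlinarith [norm_nonneg z])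
  linarith

theorem norm_mobius_le_one (ha0 : 0 ≤ a) (ha1 : a < 1) {z : ℂ} (hz : ‖z‖ ≤ 1) :
    ‖(z + a) / (1 + (a : ℂ) * z)‖ ≤ 1 := by
  have h0 := norm_pos_iff.2 (one_add_ofReal_mul_ne_zero ha0 ha1 hz)
  rw [norm_div, div_le_one h0]
  refine le_of_sq_le_sq ?_ h0.le
  have h1 := norm_sq_one_add_sub_norm_sq (a := a) z
  have h2 : 0 ≤ (1 - a ^ 2) * (1 - ‖z‖ ^ 2) :=
    mul_nonneg (by nlinarith) (by nlinarith [norm_nonneg z])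
  linarith

theorem injOn_mobius (ha0 : 0 ≤ a) (ha1 : a < 1) :
    Set.InjOn (fun z : ℂ => (z + a) / (1 + (a : ℂ) * z)) (ball (0 : ℂ) 1) := by
  intro z hz w hw h
  have hz' := one_add_ofReal_mul_ne_zero ha0 ha1 (mem_ball_zero_iff.1 hz).le
  have hw' := one_add_ofReal_mul_ne_zero ha0 ha1 (mem_ball_zero_iff.1 hw).le
  simp only [div_eq_div_iff hz' hw'] at h
  have h1 : (1 - (a : ℂ) ^ 2) * (z - w) = 0 := by linear_combination h
  have h2 : (1 - (a : ℂ) ^ 2) ≠ 0 := by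
    have : (1 - a ^ 2 : ℝ) ≠ 0 := by nlinarith
    exact_mod_cast this
  exact sub_eq_zero.1 ((mul_eq_zero.1 h1).resolve_left h2)

/-- The Poisson kernel at the point `a` of the real axis. -/
noncomputable def poissonReal (a s : ℝ) : ℝ := (1 - a ^ 2) / (1 + a ^ 2 - 2 * a * Real.cos s)

theorem poissonReal_denom_pos (ha0 : 0 ≤ a) (ha1 : a < 1) (s : ℝ) :
    0 < 1 + a ^ 2 - 2 * a * Real.cos s := by
  nlinarith [Real.cos_le_one s, mul_le_mul_of_nonneg_left (Real.cos_le_one s) ha0]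

theorem continuous_poissonReal (ha0 : 0 ≤ a) (ha1 : a < 1) : Continuous (poissonReal a) := by
  unfold poissonReal
  exact continuous_const.div (by fun_prop) fun s => (poissonReal_denom_pos ha0 ha1 s).ne'

theorem poissonReal_le (ha0 : 0 ≤ a) (ha1 : a < 1) (s : ℝ) : poissonReal a s ≤ 2 / (1 - a) := by
  unfold poissonReal
  rw [div_le_div_iff₀ (poissonReal_denom_pos ha0 ha1 s) (by linarith)]
  have h1 := mul_le_mul_of_nonneg_left (Real.cos_le_one s) ha0
  nlinarith [sq_nonneg (1 - a)]

theorem le_poissonReal (ha0 : 1 / 2 ≤ a) (ha1 : a < 1) {s : ℝ} (hs : |s| ≤ (1 - a) / 2) :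
    1 / (1 - a) ≤ poissonReal a s := by
  unfold poissonReal
  rw [div_le_div_iff₀ (by linarith) (poissonReal_denom_pos (by linarith) ha1 s)]
  have h1 := Real.one_sub_sq_div_two_le_cos (x := s)
  have h2 : s ^ 2 ≤ ((1 - a) / 2) ^ 2 := sq_le_sq' (by linarith [neg_le_of_abs_le hs])
    (le_of_abs_le hs)
  nlinarith [mul_le_mul_of_nonneg_left h1 (by linarith : (0 : ℝ) ≤ a)]

theorem poissonReal_nonneg (ha0 : 0 ≤ a) (ha1 : a < 1) (s : ℝ) : 0 ≤ poissonReal a s :=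
  div_nonneg (by nlinarith) (poissonReal_denom_pos ha0 ha1 s).le

/-- The boundary values of the disk automorphism `u ↦ (u - a) / (1 - a u)` in angular coordinates. -/
theorem exp_integral_poissonReal (ha0 : 0 ≤ a) (ha1 : a < 1) (s : ℝ) :
    Complex.exp ((∫ x in (0 : ℝ)..s, poissonReal a x : ℝ) * Complex.I) =
      (Complex.exp (s * Complex.I) - a) / (1 - a * Complex.exp (s * Complex.I)) := by
  set ψ : ℝ → ℝ := fun s => ∫ x in (0 : ℝ)..s, poissonReal a x with hψ
  have hψd : ∀ s, HasDerivAt ψ (poissonReal a s) s := fun s =>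
    ((continuous_poissonReal ha0 ha1).integral_hasStrictDerivAt 0 s).hasDerivAt
  have hu : ∀ s : ℝ, HasDerivAt (fun s : ℝ => Complex.exp (s * Complex.I))
      (Complex.exp (s * Complex.I) * Complex.I) s := by
    intro s
    have h1 : HasDerivAt (fun s : ℝ => (s : ℂ) * Complex.I) Complex.I s := by
      simpa using (Complex.ofRealCLM.hasDerivAt (x := s)).mul_const Complex.I
    exact h1.cexp
  have hden : ∀ s : ℝ, 1 - (a : ℂ) * Complex.exp (s * Complex.I) ≠ 0 := by
    intro s
    have := one_add_ofReal_mul_ne_zero ha0 ha1 (z := -Complex.exp (s * Complex.I))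
      (by rw [norm_neg, Complex.norm_exp_ofReal_mul_I])
    rwa [mul_neg, ← sub_eq_add_neg] at this
  set Q : ℝ → ℂ := fun s => (Complex.exp (s * Complex.I) - a) /
    (1 - a * Complex.exp (s * Complex.I)) * Complex.exp (-(ψ s * Complex.I)) with hQ
  have hQd : ∀ s, HasDerivAt Q 0 s := by
    intro s
    have h1 := ((hu s).sub_const (a : ℂ)).fun_div (((hu s).const_mul (a : ℂ)).const_sub 1) (hden s)
    have h2 : HasDerivAt (fun s : ℝ => -((ψ s : ℂ) * Complex.I))
        (-((poissonReal a s : ℂ) * Complex.I)) s :=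
      ((hψd s).ofReal_comp.mul_const Complex.I).neg
    refine (h1.fun_mul h2.cexp).congr_deriv ?_
    have hP : (poissonReal a s : ℂ) * ((1 - a * Complex.exp (s * Complex.I)) *
        (Complex.exp (s * Complex.I) - a)) = (1 - (a : ℂ) ^ 2) * Complex.exp (s * Complex.I) := by
      have h3 : ((1 + a ^ 2 - 2 * a * Real.cos s : ℝ) : ℂ) ≠ 0 := by
        exact_mod_cast (poissonReal_denom_pos ha0 ha1 s).ne'
      have h4 : (poissonReal a s : ℂ) * ((1 + a ^ 2 - 2 * a * Real.cos s : ℝ) : ℂ) =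
          1 - (a : ℂ) ^ 2 := by
        unfold poissonReal
        push_cast at h3 ⊢
        rw [div_mul_cancel₀ _ h3]
      have h5 : (1 - a * Complex.exp (s * Complex.I)) * (Complex.exp (s * Complex.I) - a) =
          ((1 + a ^ 2 - 2 * a * Real.cos s : ℝ) : ℂ) * Complex.exp (s * Complex.I) := by
        push_cast
        rw [Complex.cos, neg_mul, Complex.exp_neg]
        have := Complex.exp_ne_zero (s * Complex.I)
        field_simp
        ring
      rw [h5, ← mul_assoc, h4]
    have hd := hden s
    generalize Complex.exp (s * Complex.I) = e at hP hd ⊢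
    generalize Complex.exp (-(ψ s * Complex.I)) = E
    rw [div_mul_eq_mul_div, div_mul_eq_mul_div, div_add_div _ _ (pow_ne_zero 2 hd) hd,
      div_eq_zero_iff]
    left
    linear_combination (-(E * Complex.I * (1 - a * e))) * hP
  have hconst : Q s = Q 0 :=
    is_const_of_deriv_eq_zero (fun s => (hQd s).differentiableAt) (fun s => (hQd s).deriv) s 0
  have hQ0 : Q 0 = 1 := by
    have h1 : (1 : ℂ) - a ≠ 0 := by
      have : (1 - a : ℝ) ≠ 0 := by linarith
      exact_mod_cast this
    simp [hQ, hψ, div_self h1]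
  rw [hQ0] at hconst
  simp only [hQ, Complex.exp_neg] at hconst
  exact ((mul_inv_eq_one₀ (Complex.exp_ne_zero _)).1 hconst).symm

end Mobius

theorem integral_arc_norm_exp_sub_one_sq_le {T : ℂ → ℂ}
    (hT : DifferentiableOn ℂ T (ball (0 : ℂ) 1)) (hTc : ContinuousOn T (closedBall (0 : ℂ) 1))
    {δ : ℝ} (hδ : 0 ≤ δ)
    (hD : ∫⁻ z in ball (0 : ℂ) 1, ENNReal.ofReal (‖deriv T z‖ ^ 2) ≤ ENNReal.ofReal (π * δ))
    {a : ℝ} (ha0 : 1 / 2 ≤ a) (ha1 : a < 1) :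
    ∫ s in (-((1 - a) / 2))..((1 - a) / 2),
      ‖Complex.exp (T (Complex.exp (s * Complex.I)) - T a) - 1‖ ^ 2 ≤
        2 * π * (1 - a) * (Real.exp δ - 1) := by
  have ha0' : 0 ≤ a := by linarith
  have hpos : 0 < 1 - a := by linarith
  set φ : ℂ → ℂ := fun z => (z + a) / (1 + (a : ℂ) * z) with hφ
  have hφd : DifferentiableOn ℂ φ (ball (0 : ℂ) 1) := by
    refine DifferentiableOn.div (by fun_prop) (by fun_prop) fun z hz => ?_
    exact one_add_ofReal_mul_ne_zero ha0' ha1 (mem_ball_zero_iff.1 hz).le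
  have hφm : Set.MapsTo φ (ball (0 : ℂ) 1) (ball (0 : ℂ) 1) := fun z hz =>
    mem_ball_zero_iff.2 (norm_mobius_lt_one ha0' ha1 (mem_ball_zero_iff.1 hz))
  have hφc : ContinuousOn φ (closedBall (0 : ℂ) 1) := by
    refine ContinuousOn.div (by fun_prop) (by fun_prop) fun z hz => ?_
    exact one_add_ofReal_mul_ne_zero ha0' ha1 (mem_closedBall_zero_iff.1 hz)
  have hφmc : Set.MapsTo φ (closedBall (0 : ℂ) 1) (closedBall (0 : ℂ) 1) := fun z hz =>
    mem_closedBall_zero_iff.2 (norm_mobius_le_one ha0' ha1 (mem_closedBall_zero_iff.1 hz))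
  set S : ℂ → ℂ := fun z => T (φ z) - T a with hS
  have hSd : DifferentiableOn ℂ S (ball (0 : ℂ) 1) :=
    (hT.comp hφd hφm).sub (differentiableOn_const _)
  have hSc : ContinuousOn S (closedBall (0 : ℂ) 1) :=
    (hTc.comp hφc hφmc).sub continuousOn_const
  have hS0 : S 0 = 0 := by simp [hS, hφ]
  have hSD : ∫⁻ z in ball (0 : ℂ) 1, ENNReal.ofReal (‖deriv S z‖ ^ 2) ≤
      ENNReal.ofReal (π * δ) := by
    refine le_trans ?_ hD
    simp only [hS, deriv_sub_const]
    exact lintegral_norm_deriv_comp_le hT hφd hφm (injOn_mobius ha0' ha1)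
  have hmain := integral_norm_exp_sub_one_sq_le_of_continuousOn hSd hSc hS0 hδ hSD
  set G : ℝ → ℝ := fun θ => ‖Complex.exp (S (circleMap 0 1 θ)) - 1‖ ^ 2 with hG
  have hGc : Continuous G := by
    have h1 : Continuous fun θ => S (circleMap 0 1 θ) :=
      hSc.comp_continuous (continuous_circleMap 0 1) fun θ => by simp
    exact ((h1.cexp.sub continuous_const).norm.pow 2)
  have hG0 : ∀ θ, 0 ≤ G θ := fun θ => by simp only [hG]; positivity
  have hGp : Function.Periodic G (2 * π) := fun θ => by simp only [hG, periodic_circleMap 0 1 θ]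
  have hPc := continuous_poissonReal ha0' ha1
  set ψ : ℝ → ℝ := fun s => ∫ x in (0 : ℝ)..s, poissonReal a x with hψ
  have hψd : ∀ s, HasDerivAt ψ (poissonReal a s) s := fun s =>
    (hPc.integral_hasStrictDerivAt 0 s).hasDerivAt
  have hψm : Monotone ψ := monotone_of_hasDerivAt_nonneg hψd
    (poissonReal_nonneg ha0' ha1)
  have hψb : ∀ s, |s| ≤ (1 - a) / 2 → |ψ s| ≤ 1 := by
    intro s hs
    have h1 := intervalIntegral.norm_integral_le_of_norm_le_const (a := 0) (b := s)
      (f := poissonReal a) (C := 2 / (1 - a)) fun x _ => by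
        rw [Real.norm_of_nonneg (poissonReal_nonneg ha0' ha1 x)]
        exact poissonReal_le ha0' ha1 x
    rw [sub_zero, Real.norm_eq_abs] at h1
    refine h1.trans ?_
    rw [div_mul_eq_mul_div, div_le_one hpos]
    linarith
  have hGψ : ∀ s : ℝ,
      ‖Complex.exp (T (Complex.exp (s * Complex.I)) - T a) - 1‖ ^ 2 = G (ψ s) := by
    intro s
    have hval : φ (circleMap 0 1 (ψ s)) = Complex.exp (s * Complex.I) := by
      have h1 : circleMap 0 1 (ψ s) = Complex.exp (ψ s * Complex.I) := by simp [circleMap]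
      rw [h1, exp_integral_poissonReal ha0' ha1 s]
      have hd : 1 - (a : ℂ) * Complex.exp (s * Complex.I) ≠ 0 := by
        have := one_add_ofReal_mul_ne_zero ha0' ha1 (z := -Complex.exp (s * Complex.I))
          (by rw [norm_neg, Complex.norm_exp_ofReal_mul_I])
        rwa [mul_neg, ← sub_eq_add_neg] at this
      have hd2 : (1 - (a : ℂ) ^ 2) ≠ 0 := by
        have : (1 - a ^ 2 : ℝ) ≠ 0 := by nlinarith
        exact_mod_cast this
      simp only [hφ]
      generalize Complex.exp (s * Complex.I) = e at hd ⊢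
      have h2 : 1 + (a : ℂ) * ((e - a) / (1 - a * e)) = (1 - (a : ℂ) ^ 2) / (1 - a * e) := by
        rw [eq_div_iff hd, add_mul, mul_assoc, div_mul_cancel₀ _ hd]
        ring
      rw [h2, div_eq_iff (div_ne_zero hd2 hd), ← mul_div_assoc, eq_div_iff hd, add_mul,
        div_mul_cancel₀ _ hd]
      ring
    simp only [hG, hS, hval]
  have hle : -((1 - a) / 2) ≤ (1 - a) / 2 := by linarith
  have habs : ∀ s ∈ Set.Icc (-((1 - a) / 2)) ((1 - a) / 2), |s| ≤ (1 - a) / 2 := fun s hs =>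
    abs_le.2 hs
  have hψc : Continuous ψ := continuous_iff_continuousAt.2 fun s => (hψd s).continuousAt
  calc ∫ s in (-((1 - a) / 2))..((1 - a) / 2),
        ‖Complex.exp (T (Complex.exp (s * Complex.I)) - T a) - 1‖ ^ 2
      = ∫ s in (-((1 - a) / 2))..((1 - a) / 2), G (ψ s) := by simp only [hGψ]
    _ ≤ ∫ s in (-((1 - a) / 2))..((1 - a) / 2), (1 - a) * ((G ∘ ψ) s * poissonReal a s) := by
        refine intervalIntegral.integral_mono_on hle
          ((hGc.comp hψc).intervalIntegrable _ _)
          ((continuous_const.mul ((hGc.comp hψc).mul hPc)).intervalIntegrable _ _) fun s hs => ?_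
        have h1 := le_poissonReal ha0 ha1 (habs s hs)
        rw [div_le_iff₀ hpos] at h1
        have h2 := mul_le_mul_of_nonneg_left h1 (hG0 (ψ s))
        simp only [Function.comp]
        linarith
    _ = (1 - a) * ∫ θ in ψ (-((1 - a) / 2))..ψ ((1 - a) / 2), G θ := by
        rw [intervalIntegral.integral_const_mul, intervalIntegral.integral_comp_mul_deriv
          (fun s _ => hψd s) hPc.continuousOn hGc]
    _ ≤ (1 - a) * ∫ θ in (-π)..π, G θ := by
        have h1 := abs_le.1 (hψb _ (habs _ (Set.left_mem_Icc.2 hle)))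
        have h2 := abs_le.1 (hψb _ (habs _ (Set.right_mem_Icc.2 hle)))
        have h3 := pi_gt_three
        gcongr
        refine intervalIntegral.integral_mono_interval (by linarith) (hψm hle) (by linarith)
          (Filter.Eventually.of_forall hG0) (hGc.intervalIntegrable _ _)
    _ = (1 - a) * ∫ θ in (0 : ℝ)..2 * π, G θ := by
        have := hGp.intervalIntegral_add_eq (-π) 0
        rw [zero_add, show -π + 2 * π = π by ring] at this
        rw [this]
    _ ≤ (1 - a) * (2 * π * (Real.exp δ - 1)) := by gcongr
    _ = 2 * π * (1 - a) * (Real.exp δ - 1) := by ring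

/-- The previous estimate, on an arc of a circle of radius `r < 1` centered at angle `s₀`. -/
theorem integral_arc_norm_exp_sub_one_sq_le_of_radius {t : ℂ → ℂ}
    (ht : DifferentiableOn ℂ t (ball (0 : ℂ) 1)) {δ : ℝ} (hδ : 0 ≤ δ)
    (hD : ∫⁻ z in ball (0 : ℂ) 1, ENNReal.ofReal (‖deriv t z‖ ^ 2) ≤ ENNReal.ofReal (π * δ))
    {h : ℝ} (hh0 : 0 < h) (hh1 : h ≤ 1 / 2) {r : ℝ} (hr0 : 0 < r) (hr1 : r < 1) (s₀ : ℝ) :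
    ∫ s in (s₀ - h / 2)..(s₀ + h / 2),
      ‖Complex.exp (t (circleMap 0 r s) - t (circleMap 0 (r * (1 - h)) s₀)) - 1‖ ^ 2 ≤
        2 * π * h * (Real.exp δ - 1) := by
  set c : ℂ := circleMap 0 r s₀ with hc
  have hcn : ‖c‖ = r := by simp [hc, abs_of_pos hr0]
  have hc0 : c ≠ 0 := norm_pos_iff.1 (hcn ▸ hr0)
  have hm : ∀ z : ℂ, ‖z‖ ≤ 1 → c * z ∈ ball (0 : ℂ) 1 := fun z hz => by
    rw [mem_ball_zero_iff, norm_mul, hcn]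
    nlinarith [norm_nonneg z]
  have hχm : Set.MapsTo (fun z => c * z) (ball (0 : ℂ) 1) (ball (0 : ℂ) 1) := fun z hz =>
    hm z (mem_ball_zero_iff.1 hz).le
  have hχd : DifferentiableOn ℂ (fun z => c * z) (ball (0 : ℂ) 1) := by fun_prop
  have hTc : ContinuousOn (fun z => t (c * z)) (closedBall (0 : ℂ) 1) :=
    ht.continuousOn.comp (by fun_prop) fun z hz => hm z (mem_closedBall_zero_iff.1 hz)
  have h1 := integral_arc_norm_exp_sub_one_sq_le (T := fun z => t (c * z)) (ht.comp hχd hχm) hTc hδ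
    ((lintegral_norm_deriv_comp_le ht hχd hχm (fun x _ y _ hxy => mul_left_cancel₀ hc0 hxy)).trans
      hD) (a := 1 - h) (by linarith) (by linarith)
  rw [sub_sub_cancel] at h1
  refine le_trans (le_of_eq ?_) h1
  have h2 := intervalIntegral.integral_comp_add_right (a := -(h / 2)) (b := h / 2)
    (fun s => ‖Complex.exp (t (circleMap 0 r s) - t (circleMap 0 (r * (1 - h)) s₀)) - 1‖ ^ 2) s₀
  rw [show -(h / 2) + s₀ = s₀ - h / 2 by ring, show h / 2 + s₀ = s₀ + h / 2 by ring] at h2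
  rw [← h2]
  refine intervalIntegral.integral_congr fun s _ => ?_
  have e1 : circleMap 0 r (s + s₀) = c * Complex.exp (s * Complex.I) := by
    simp only [hc, circleMap, zero_add]
    rw [mul_assoc, ← Complex.exp_add]
    push_cast
    ring_nf
  have e2 : circleMap 0 (r * (1 - h)) s₀ = c * ((1 - h : ℝ) : ℂ) := by
    simp only [hc, circleMap, zero_add]
    push_cast
    ring
  simp only [e1, e2]

theorem hasDerivAt_comp_circleMap {F : ℂ → ℂ} (hF : DifferentiableOn ℂ F (ball (0 : ℂ) 1))
    {r : ℝ} (hr0 : 0 < r) (hr1 : r < 1) (s : ℝ) :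
    HasDerivAt (fun s => F (circleMap 0 r s)) (deriv F (circleMap 0 r s) *
      (circleMap 0 r s * Complex.I)) s := by
  have hmem : circleMap 0 r s ∈ ball (0 : ℂ) 1 := by simpa [abs_of_pos hr0] using hr1
  exact ((hF.differentiableAt (isOpen_ball.mem_nhds hmem)).hasDerivAt).comp s
    (hasDerivAt_circleMap 0 r s)

/-- If the logarithm of `F'` has finite Dirichlet integral, then `F'` is in mean close to a constant
on short arcs. -/
theorem exists_integral_arc_norm_deriv_div_sub_one_le {F g : ℂ → ℂ}
    (hg : DifferentiableOn ℂ g (ball (0 : ℂ) 1))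
    (hFg : ∀ z ∈ ball (0 : ℂ) 1, deriv F z = Complex.exp (g z))
    (hD : ∫⁻ z in ball (0 : ℂ) 1, ENNReal.ofReal (‖deriv g z‖ ^ 2) < ⊤) :
    ∃ h₀ : ℝ, 0 < h₀ ∧ h₀ ≤ 1 / 2 ∧ ∀ h : ℝ, 0 < h → h ≤ h₀ → ∀ r : ℝ, 0 < r → r < 1 → ∀ s₀ : ℝ,
      ∫ s in (s₀ - h / 2)..(s₀ + h / 2), ‖deriv F (circleMap 0 r s) /
        deriv F (circleMap 0 (r * (1 - h)) s₀) - 1‖ ≤ h / 4 := by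
  set δ : ℝ := Real.log (1 + 1 / 1000) with hδd
  have hδ : 0 < δ := Real.log_pos (by norm_num)
  have hexpδ : Real.exp δ = 1 + 1 / 1000 := Real.exp_log (by norm_num)
  obtain ⟨P, K, hK, hPL, htd, htD⟩ := exists_lipschitz_sub_small_dirichlet hg hD hδ
  set t : ℂ → ℂ := fun z => g z - P z with ht
  refine ⟨min (1 / 2) (1 / (200 * (K + 1))), by positivity, min_le_left _ _, ?_⟩
  intro h hh0 hh r hr0 hr1 s₀
  have hh1 : h ≤ 1 / 2 := hh.trans (min_le_left _ _)
  have hhK : 2 * K * h ≤ 1 / 100 := by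
    have h1 : h ≤ 1 / (200 * (K + 1)) := hh.trans (min_le_right _ _)
    rw [le_div_iff₀ (by positivity)] at h1
    nlinarith
  have hmem : ∀ s, circleMap 0 r s ∈ ball (0 : ℂ) 1 := fun s => by
    simpa [abs_of_pos hr0] using hr1
  set p : ℂ := circleMap 0 (r * (1 - h)) s₀ with hp
  have hpm : p ∈ ball (0 : ℂ) 1 := by
    have h1 : 0 < r * (1 - h) := mul_pos hr0 (by linarith)
    have : r * (1 - h) < 1 := by nlinarith
    simp only [hp, mem_ball_zero_iff, norm_circleMap_zero, abs_of_pos h1, this]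
  have hdist : ∀ s ∈ Set.Icc (s₀ - h / 2) (s₀ + h / 2), ‖circleMap 0 r s - p‖ ≤ 2 * h := by
    intro s hs
    have h1 : circleMap 0 r s - p = r * (Complex.exp (s * Complex.I) -
        Complex.exp (s₀ * Complex.I)) + r * h * Complex.exp (s₀ * Complex.I) := by
      simp only [hp, circleMap]
      push_cast
      ring
    have h2 : ‖Complex.exp (s * Complex.I) - Complex.exp (s₀ * Complex.I)‖ ≤ |s - s₀| := by
      have h3 : Complex.exp (s * Complex.I) - Complex.exp (s₀ * Complex.I) =
          Complex.exp (s₀ * Complex.I) * (Complex.exp (Complex.I * ((s - s₀ : ℝ) : ℂ)) - 1) := by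
        rw [mul_sub, ← Complex.exp_add]
        push_cast
        ring_nf
      rw [h3, norm_mul, Complex.norm_exp_ofReal_mul_I, one_mul]
      exact Real.norm_exp_I_mul_ofReal_sub_one_le
    have h4 : |s - s₀| ≤ h / 2 := abs_le.2 ⟨by linarith [hs.1], by linarith [hs.2]⟩
    rw [h1]
    refine (norm_add_le _ _).trans ?_
    rw [norm_mul, norm_mul, norm_mul, Complex.norm_exp_ofReal_mul_I, Complex.norm_real,
      Complex.norm_real, Real.norm_of_nonneg hr0.le, Real.norm_of_nonneg hh0.le]
    nlinarith [norm_nonneg (Complex.exp (s * Complex.I) - Complex.exp (s₀ * Complex.I))]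
  have hcirc := continuous_circleMap 0 r
  have hgc : Continuous fun s => g (circleMap 0 r s) := hg.continuousOn.comp_continuous hcirc hmem
  have htc : Continuous fun s => t (circleMap 0 r s) := htd.continuousOn.comp_continuous hcirc hmem
  have hratio : ∀ s, deriv F (circleMap 0 r s) / deriv F p =
      Complex.exp (g (circleMap 0 r s) - g p) := fun s => by
    rw [hFg _ (hmem s), hFg _ hpm, Complex.exp_sub]
  simp only [hratio]
  have hpt : ∀ s ∈ Set.Icc (s₀ - h / 2) (s₀ + h / 2),
      ‖Complex.exp (g (circleMap 0 r s) - g p) - 1‖ ≤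
        2 * (5 * ‖Complex.exp (t (circleMap 0 r s) - t p) - 1‖ ^ 2 + 1 / 20) + 1 / 50 := by
    intro s hs
    set v := t (circleMap 0 r s) - t p with hv
    set u := P (circleMap 0 r s) - P p with hu
    have hu1 : ‖u‖ ≤ 1 / 100 := by
      refine (hPL _ (hmem s) _ hpm).trans (le_trans ?_ hhK)
      nlinarith [hdist s hs]
    have huv : g (circleMap 0 r s) - g p = u + v := by simp only [hu, hv, ht]; ring
    have h1 : ‖Complex.exp u - 1‖ ≤ 1 / 50 :=
      (Complex.norm_exp_sub_one_le (hu1.trans (by norm_num))).trans (by linarith)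
    have h2 : ‖Complex.exp u‖ ≤ 2 := by
      calc ‖Complex.exp u‖ = ‖(Complex.exp u - 1) + 1‖ := by rw [sub_add_cancel]
        _ ≤ ‖Complex.exp u - 1‖ + ‖(1 : ℂ)‖ := norm_add_le _ _
        _ ≤ 2 := by rw [norm_one]; linarith
    have h3 : Complex.exp (u + v) - 1 =
        Complex.exp u * (Complex.exp v - 1) + (Complex.exp u - 1) := by
      rw [Complex.exp_add]
      ring
    rw [huv, h3]
    refine (norm_add_le _ _).trans ?_
    rw [norm_mul]
    have h4 : ‖Complex.exp v - 1‖ ≤ 5 * ‖Complex.exp v - 1‖ ^ 2 + 1 / 20 := by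
      nlinarith [sq_nonneg (‖Complex.exp v - 1‖ - 1 / 10)]
    have h5 := mul_le_mul h2 h4 (norm_nonneg _) zero_le_two
    linarith
  have hcQ : Continuous fun s => ‖Complex.exp (t (circleMap 0 r s) - t p) - 1‖ ^ 2 :=
    ((htc.sub continuous_const).cexp.sub continuous_const).norm.pow 2
  have hle : s₀ - h / 2 ≤ s₀ + h / 2 := by linarith
  have hmain := integral_arc_norm_exp_sub_one_sq_le_of_radius htd hδ.le htD hh0 hh1 hr0 hr1 s₀
  rw [hexpδ] at hmain
  calc _ ≤ ∫ s in (s₀ - h / 2)..(s₀ + h / 2),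
        (10 * ‖Complex.exp (t (circleMap 0 r s) - t p) - 1‖ ^ 2 + 3 / 25) := by
        refine intervalIntegral.integral_mono_on hle ?_ ?_ fun s hs => ?_
        · exact (((hgc.sub continuous_const).cexp.sub
            continuous_const).norm).intervalIntegrable _ _
        · exact ((continuous_const.mul hcQ).add continuous_const).intervalIntegrable _ _
        · linarith [hpt s hs]
    _ = 10 * (∫ s in (s₀ - h / 2)..(s₀ + h / 2),
        ‖Complex.exp (t (circleMap 0 r s) - t p) - 1‖ ^ 2) + h * (3 / 25) := by
        have hc10 : Continuous fun s =>
            10 * ‖Complex.exp (t (circleMap 0 r s) - t p) - 1‖ ^ 2 := continuous_const.mul hcQ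
        rw [intervalIntegral.integral_add (hc10.intervalIntegrable _ _)
          (continuous_const.intervalIntegrable _ _), intervalIntegral.integral_const_mul,
          intervalIntegral.integral_const, smul_eq_mul]
        ring
    _ ≤ 10 * (2 * π * h * (1 + 1 / 1000 - 1)) + h * (3 / 25) := by gcongr
    _ ≤ h / 4 := by nlinarith [pi_lt_d2]

/-- Short arcs of the image curves `s ↦ F (r e^{is})` are comparable to their chords, with a lower
bound on the chord length. -/
theorem exists_arc_length_le_chord {F g : ℂ → ℂ}
    (hF : DifferentiableOn ℂ F (ball (0 : ℂ) 1)) (hg : DifferentiableOn ℂ g (ball (0 : ℂ) 1))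
    (hFg : ∀ z ∈ ball (0 : ℂ) 1, deriv F z = Complex.exp (g z))
    (hD : ∫⁻ z in ball (0 : ℂ) 1, ENNReal.ofReal (‖deriv g z‖ ^ 2) < ⊤) :
    ∃ h₀ : ℝ, 0 < h₀ ∧ h₀ ≤ 1 / 2 ∧ ∀ a b : ℝ, a < b → b - a ≤ h₀ → ∀ r : ℝ, 0 < r → r < 1 →
      (∫ s in a..b, ‖deriv F (circleMap 0 r s) * (circleMap 0 r s * Complex.I)‖ ≤
        3 * ‖F (circleMap 0 r b) - F (circleMap 0 r a)‖) ∧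
      ‖deriv F (circleMap 0 (r * (1 - (b - a))) ((a + b) / 2))‖ * r * (b - a) / 2 ≤
        ‖F (circleMap 0 r b) - F (circleMap 0 r a)‖ := by
  obtain ⟨h₀, hh₀, hh₀1, H⟩ := exists_integral_arc_norm_deriv_div_sub_one_le hg hFg hD
  refine ⟨h₀, hh₀, hh₀1, fun a b hab hb r hr0 hr1 => ?_⟩
  set h : ℝ := b - a with hh
  have hh0 : 0 < h := sub_pos.2 hab
  have key := H h hh0 hb r hr0 hr1 ((a + b) / 2)
  rw [show (a + b) / 2 - h / 2 = a by rw [hh]; ring,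
    show (a + b) / 2 + h / 2 = b by rw [hh]; ring] at key
  set s₀ : ℝ := (a + b) / 2 with hs₀
  set A : ℂ := deriv F (circleMap 0 (r * (1 - h)) s₀) with hA
  have hmem : ∀ s, circleMap 0 r s ∈ ball (0 : ℂ) 1 := fun s => by
    simpa [abs_of_pos hr0] using hr1
  have hA0 : A ≠ 0 := by
    have h1 : 0 < r * (1 - h) := mul_pos hr0 (by linarith)
    have h2 : r * (1 - h) < 1 := by nlinarith
    rw [hA, hFg _ (by simp only [mem_ball_zero_iff, norm_circleMap_zero, abs_of_pos h1, h2])]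
    exact Complex.exp_ne_zero _
  have hcirc := continuous_circleMap 0 r
  have hF'c : Continuous fun s => deriv F (circleMap 0 r s) :=
    (hF.deriv isOpen_ball).continuousOn.comp_continuous hcirc hmem
  set E : ℝ → ℂ := fun s => deriv F (circleMap 0 r s) / A - 1 with hE
  have hEc : Continuous E := (hF'c.div_const A).sub continuous_const
  have hfac : ∀ s, deriv F (circleMap 0 r s) = A * (1 + E s) := fun s => by
    simp only [hE]
    field_simp
    ring
  have hvel : ∀ s, ‖deriv F (circleMap 0 r s) * (circleMap 0 r s * Complex.I)‖ =
      ‖A‖ * r * ‖1 + E s‖ := fun s => by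
    rw [hfac, norm_mul, norm_mul, norm_mul, norm_circleMap_zero, Complex.norm_I, abs_of_pos hr0]
    ring
  have hchord : ‖A‖ * r * h / 2 ≤ ‖F (circleMap 0 r b) - F (circleMap 0 r a)‖ := by
    have hFTC : ∫ s in a..b, deriv F (circleMap 0 r s) * (circleMap 0 r s * Complex.I) =
        F (circleMap 0 r b) - F (circleMap 0 r a) :=
      intervalIntegral.integral_eq_sub_of_hasDerivAt
        (fun s _ => hasDerivAt_comp_circleMap hF hr0 hr1 s)
        ((hF'c.mul (hcirc.mul continuous_const)).intervalIntegrable _ _)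
    set u : ℂ := Complex.exp (s₀ * Complex.I) with hu
    set R : ℝ → ℂ := fun s => (Complex.exp (s * Complex.I) - u) +
      E s * Complex.exp (s * Complex.I) with hR
    have hec : Continuous fun s : ℝ => Complex.exp (s * Complex.I) := by fun_prop
    have hRc : Continuous R := (hec.sub continuous_const).add (hEc.mul hec)
    have hsplit : F (circleMap 0 r b) - F (circleMap 0 r a) =
        A * r * Complex.I * (h * u + ∫ s in a..b, R s) := by
      have h1 : ∀ s, deriv F (circleMap 0 r s) * (circleMap 0 r s * Complex.I) =
          A * r * Complex.I * (u + R s) := fun s => by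
        rw [hfac]
        simp only [circleMap, hR, zero_add]
        ring
      rw [← hFTC]
      simp only [h1]
      rw [intervalIntegral.integral_const_mul, intervalIntegral.integral_add
        (continuous_const.intervalIntegrable _ _) (hRc.intervalIntegrable _ _),
        intervalIntegral.integral_const, Complex.real_smul]
    have hRb : ‖∫ s in a..b, R s‖ ≤ h / 2 := by
      calc ‖∫ s in a..b, R s‖ ≤ ∫ s in a..b, ‖R s‖ :=
            intervalIntegral.norm_integral_le_integral_norm hab.le
        _ ≤ ∫ s in a..b, (h / 2 + ‖E s‖) := by
            refine intervalIntegral.integral_mono_on hab.le (hRc.norm.intervalIntegrable _ _)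
              ((continuous_const.add hEc.norm).intervalIntegrable _ _) fun s hs => ?_
            refine (norm_add_le _ _).trans ?_
            rw [norm_mul, Complex.norm_exp_ofReal_mul_I, mul_one]
            gcongr
            have h3 : Complex.exp (s * Complex.I) - u =
                u * (Complex.exp (Complex.I * ((s - s₀ : ℝ) : ℂ)) - 1) := by
              rw [mul_sub, hu, ← Complex.exp_add]
              push_cast
              ring_nf
            rw [h3, norm_mul, hu, Complex.norm_exp_ofReal_mul_I, one_mul]
            refine Real.norm_exp_I_mul_ofReal_sub_one_le.trans (abs_le.2 ⟨?_, ?_⟩)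
            · linarith [hs.1]
            · linarith [hs.2]
        _ = h * (h / 2) + ∫ s in a..b, ‖E s‖ := by
            rw [intervalIntegral.integral_add (continuous_const.intervalIntegrable _ _)
              (hEc.norm.intervalIntegrable _ _), intervalIntegral.integral_const, smul_eq_mul]
        _ ≤ h * (h / 2) + h / 4 := by gcongr
        _ ≤ h / 2 := by nlinarith
    rw [hsplit, norm_mul, norm_mul, norm_mul, Complex.norm_I, Complex.norm_real,
      Real.norm_of_nonneg hr0.le, mul_one, mul_div_assoc]
    refine mul_le_mul_of_nonneg_left ?_ (by positivity)
    have h4 : ‖(h : ℂ) * u‖ = h := by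
      rw [norm_mul, hu, Complex.norm_exp_ofReal_mul_I, Complex.norm_real,
        Real.norm_of_nonneg hh0.le, mul_one]
    have h5 := norm_sub_le_norm_add ((h : ℂ) * u) (∫ s in a..b, R s)
    linarith
  refine ⟨?_, hchord⟩
  simp only [hvel]
  rw [intervalIntegral.integral_const_mul]
  have hlen : ∫ s in a..b, ‖1 + E s‖ ≤ 5 / 4 * h := by
    calc ∫ s in a..b, ‖1 + E s‖ ≤ ∫ s in a..b, (1 + ‖E s‖) := by
          refine intervalIntegral.integral_mono_on hab.le
            ((continuous_const.add hEc).norm.intervalIntegrable _ _)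
            ((continuous_const.add hEc.norm).intervalIntegrable _ _) fun s hs => ?_
          refine (norm_add_le _ _).trans ?_
          rw [norm_one]
      _ = h + ∫ s in a..b, ‖E s‖ := by
          rw [intervalIntegral.integral_add (continuous_const.intervalIntegrable _ _)
            (hEc.norm.intervalIntegrable _ _), intervalIntegral.integral_const, smul_eq_mul,
            mul_one]
      _ ≤ 5 / 4 * h := by linarith
  have h6 := mul_le_mul_of_nonneg_left hlen (by positivity : 0 ≤ ‖A‖ * r)
  have h7 : 0 ≤ ‖A‖ * r * h := by positivity
  linarith

theorem summable_taylor_coeff_of_log_deriv {F g : ℂ → ℂ}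
    (hg : DifferentiableOn ℂ g (ball (0 : ℂ) 1))
    (hFg : ∀ z ∈ ball (0 : ℂ) 1, deriv F z = Complex.exp (g z))
    (hD : ∫⁻ z in ball (0 : ℂ) 1, ENNReal.ofReal (‖deriv g z‖ ^ 2) < ⊤) :
    Summable fun n : ℕ => ‖(n.factorial : ℂ)⁻¹ * iteratedDeriv n F 0‖ := by
  set I := ∫⁻ z in ball (0 : ℂ) 1, ENNReal.ofReal (‖deriv g z‖ ^ 2) with hI
  have hgT : DifferentiableOn ℂ (fun z => g z - g 0) (ball (0 : ℂ) 1) :=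
    hg.sub (differentiableOn_const _)
  obtain ⟨b, -, hb, -, hbs, -⟩ := exists_hasSum_exp_of_dirichlet hgT (sub_self _)
    (δ := I.toReal / π) (by positivity) (by
      rw [mul_div_cancel₀ _ pi_ne_zero, ENNReal.ofReal_toReal hD.ne]
      simp only [deriv_sub_const]
      exact le_rfl)
  have hderiv : deriv F =ᶠ[nhds 0] fun z => Complex.exp (g 0) * Complex.exp (g z - g 0) := by
    filter_upwards [ball_mem_nhds (0 : ℂ) one_pos] with z hz
    rw [hFg z hz, ← Complex.exp_add, add_sub_cancel]
  have hcoeff : ∀ n : ℕ, (((n + 1).factorial : ℂ)⁻¹ * iteratedDeriv (n + 1) F 0) =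
      Complex.exp (g 0) * (b n * ((n : ℂ) + 1)⁻¹) := by
    intro n
    have hsm : ContDiffAt ℂ n (fun z => Complex.exp (g z - g 0)) 0 :=
      (hgT.cexp.analyticAt (ball_mem_nhds (0 : ℂ) one_pos)).contDiffAt
    rw [iteratedDeriv_succ', hderiv.iteratedDeriv_eq, iteratedDeriv_const_mul _ hsm, hb,
      Nat.factorial_succ]
    push_cast
    rw [mul_inv]
    ring
  rw [← summable_nat_add_iff 1]
  have h1 : Summable fun n : ℕ => (1 : ℝ) / ((n : ℝ) + 1) ^ 2 := by
    have := (summable_nat_add_iff 1).2 (Real.summable_one_div_nat_pow.2 one_lt_two)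
    simpa using this
  refine Summable.of_nonneg_of_le (fun _ => norm_nonneg _) (fun n => ?_)
    ((hbs.add h1).mul_left ‖Complex.exp (g 0)‖)
  have h0 : (0 : ℝ) < (n : ℝ) + 1 := by positivity
  rw [hcoeff, norm_mul, norm_mul, norm_inv]
  gcongr
  have h2 : ‖(n : ℂ) + 1‖ = (n : ℝ) + 1 := by
    have : ((n : ℂ) + 1) = ((n : ℝ) + 1 : ℝ) := by push_cast; rfl
    rw [this, Complex.norm_real, Real.norm_of_nonneg h0.le]
  rw [h2, one_div, ← inv_pow]
  nlinarith [sq_nonneg (‖b n‖ - ((n : ℝ) + 1)⁻¹), norm_nonneg (b n), inv_pos.2 h0,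
    mul_nonneg (norm_nonneg (b n)) (inv_pos.2 h0).le]

theorem exists_continuousOn_closedBall_extension {F g : ℂ → ℂ}
    (hF : DifferentiableOn ℂ F (ball (0 : ℂ) 1)) (hg : DifferentiableOn ℂ g (ball (0 : ℂ) 1))
    (hFg : ∀ z ∈ ball (0 : ℂ) 1, deriv F z = Complex.exp (g z))
    (hD : ∫⁻ z in ball (0 : ℂ) 1, ENNReal.ofReal (‖deriv g z‖ ^ 2) < ⊤) :
    ∃ Φ : ℂ → ℂ, ContinuousOn Φ (closedBall (0 : ℂ) 1) ∧ Set.EqOn Φ F (ball (0 : ℂ) 1) := by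
  set c : ℕ → ℂ := fun n => (n.factorial : ℂ)⁻¹ * iteratedDeriv n F 0 with hc
  refine ⟨fun z => ∑' n, c n * z ^ n, ?_, fun z hz => (hasSum_taylor_unit_ball hF hz).tsum_eq⟩
  refine continuousOn_tsum (fun n => by fun_prop) (summable_taylor_coeff_of_log_deriv hg hFg hD)
    fun n z hz => ?_
  rw [norm_mul, norm_pow]
  exact mul_le_of_le_one_right (norm_nonneg _)
    (pow_le_one₀ (norm_nonneg _) (mem_closedBall_zero_iff.1 hz))

theorem eVariationOn_Icc_le_integral {f : ℝ → ℂ} {φ : ℝ → ℝ} {a b : ℝ} (hφ : ∀ x, 0 ≤ φ x)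
    (h_int : ∀ x y, IntervalIntegrable φ volume x y)
    (h : ∀ x y, x ≤ y → ‖f y - f x‖ ≤ ∫ s in x..y, φ s) :
    eVariationOn f (Set.Icc a b) ≤ ENNReal.ofReal (∫ s in a..b, φ s) := by
  refine iSup_le ?_
  rintro ⟨n, u, hu, hus⟩
  have hterm : ∀ i, edist (f (u (i + 1))) (f (u i)) ≤
      ENNReal.ofReal (∫ s in (u i)..(u (i + 1)), φ s) := by
    intro i
    rw [edist_dist, dist_eq_norm]
    exact ENNReal.ofReal_le_ofReal (h _ _ (hu (Nat.le_succ i)))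
  refine (Finset.sum_le_sum fun i _ => hterm i).trans ?_
  rw [← ENNReal.ofReal_sum_of_nonneg fun i _ =>
    intervalIntegral.integral_nonneg (hu (Nat.le_succ i)) fun _ _ => hφ _]
  refine ENNReal.ofReal_le_ofReal ?_
  rw [intervalIntegral.sum_integral_adjacent_intervals fun i _ => h_int _ _]
  exact intervalIntegral.integral_mono_interval (hus 0).1 (hu (Nat.zero_le n)) (hus n).2
    (Filter.Eventually.of_forall hφ) (h_int _ _)

theorem eVariationOn_Icc_le_integral_norm_deriv {f f' : ℝ → ℂ} {a b : ℝ}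
    (hf : ∀ s, HasDerivAt f (f' s) s) (hf' : Continuous f') :
    eVariationOn f (Set.Icc a b) ≤ ENNReal.ofReal (∫ s in a..b, ‖f' s‖) := by
  refine eVariationOn_Icc_le_integral (fun _ => norm_nonneg _)
    (fun x y => hf'.norm.intervalIntegrable x y) fun x y hxy => ?_
  rw [← intervalIntegral.integral_eq_sub_of_hasDerivAt (fun s _ => hf s)
    (hf'.intervalIntegrable _ _)]
  exact intervalIntegral.norm_integral_le_integral_norm hxy

theorem tendsto_circleMap_radius (s : ℝ) {r₀ : ℝ} :
    Filter.Tendsto (fun r : ℝ => circleMap 0 r s) (nhds r₀) (nhds (circleMap 0 r₀ s)) := by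
  have : Continuous fun r : ℝ => circleMap 0 r s := by
    unfold circleMap
    fun_prop
  exact this.tendsto r₀

theorem tendsto_boundary_value {F Φ : ℂ → ℂ} (hΦ : ContinuousOn Φ (closedBall (0 : ℂ) 1))
    (hΦF : Set.EqOn Φ F (ball (0 : ℂ) 1)) (s : ℝ) :
    Filter.Tendsto (fun r : ℝ => F (circleMap 0 r s)) (nhdsWithin 1 (Set.Iio 1))
      (nhds (Φ (circleMap 0 1 s))) := by
  have hIoo : ∀ᶠ r in nhdsWithin (1 : ℝ) (Set.Iio 1), r ∈ Set.Ioo (0 : ℝ) 1 :=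
    Ioo_mem_nhdsLT one_pos
  have hlim : Filter.Tendsto (fun r : ℝ => Φ (circleMap 0 r s)) (nhdsWithin 1 (Set.Iio 1))
      (nhds (Φ (circleMap 0 1 s))) := by
    refine (hΦ _ (by simp)).tendsto.comp (tendsto_nhdsWithin_iff.2
      ⟨(tendsto_circleMap_radius s).mono_left nhdsWithin_le_nhds, ?_⟩)
    filter_upwards [hIoo] with r hr
    simp [abs_of_pos hr.1, hr.2.le]
  refine hlim.congr' ?_
  filter_upwards [hIoo] with r hr
  exact hΦF (by simp [abs_of_pos hr.1, hr.2])

/-- Short arcs of the boundary curve are rectifiable, with length comparable to their chord, and the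
boundary curve is locally injective. -/
theorem exists_eVariationOn_boundary_le {F g Φ : ℂ → ℂ}
    (hF : DifferentiableOn ℂ F (ball (0 : ℂ) 1)) (hg : DifferentiableOn ℂ g (ball (0 : ℂ) 1))
    (hFg : ∀ z ∈ ball (0 : ℂ) 1, deriv F z = Complex.exp (g z))
    (hD : ∫⁻ z in ball (0 : ℂ) 1, ENNReal.ofReal (‖deriv g z‖ ^ 2) < ⊤)
    (hΦ : ContinuousOn Φ (closedBall (0 : ℂ) 1)) (hΦF : Set.EqOn Φ F (ball (0 : ℂ) 1)) :
    ∃ h₀ : ℝ, 0 < h₀ ∧ h₀ ≤ 1 / 2 ∧ ∀ a b : ℝ, a < b → b - a ≤ h₀ →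
      Φ (circleMap 0 1 a) ≠ Φ (circleMap 0 1 b) ∧
      eVariationOn (fun s => Φ (circleMap 0 1 s)) (Set.Icc a b) ≤
        ENNReal.ofReal (3 * ‖Φ (circleMap 0 1 b) - Φ (circleMap 0 1 a)‖) := by
  obtain ⟨h₀, hh₀, hh₀1, H⟩ := exists_arc_length_le_chord hF hg hFg hD
  refine ⟨h₀, hh₀, hh₀1, fun a b hab hb => ?_⟩
  have hIoo : ∀ᶠ r in nhdsWithin (1 : ℝ) (Set.Iio 1), r ∈ Set.Ioo (0 : ℝ) 1 :=
    Ioo_mem_nhdsLT one_pos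
  have hlim := tendsto_boundary_value hΦ hΦF
  have hchord : Filter.Tendsto (fun r => ‖F (circleMap 0 r b) - F (circleMap 0 r a)‖)
      (nhdsWithin (1 : ℝ) (Set.Iio 1))
      (nhds ‖Φ (circleMap 0 1 b) - Φ (circleMap 0 1 a)‖) := ((hlim b).sub (hlim a)).norm
  have hF'c : ContinuousOn (deriv F) (ball (0 : ℂ) 1) := (hF.deriv isOpen_ball).continuousOn
  constructor
  · intro heq
    set p := circleMap 0 (1 - (b - a)) ((a + b) / 2) with hp
    have hpm : p ∈ ball (0 : ℂ) 1 := by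
      have h1 : 0 < 1 - (b - a) := by linarith
      have h2 : 1 - (b - a) < 1 := by linarith
      simp only [hp, mem_ball_zero_iff, norm_circleMap_zero, abs_of_pos h1, h2]
    have hlow : Filter.Tendsto (fun r => ‖deriv F (circleMap 0 (r * (1 - (b - a))) ((a + b) / 2))‖ *
        r * (b - a) / 2) (nhdsWithin (1 : ℝ) (Set.Iio 1))
        (nhds (‖deriv F p‖ * 1 * (b - a) / 2)) := by
      have hid : Filter.Tendsto (fun r : ℝ => r) (nhdsWithin (1 : ℝ) (Set.Iio 1)) (nhds 1) :=
        tendsto_nhdsWithin_of_tendsto_nhds Filter.tendsto_id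
      have h1 : Filter.Tendsto (fun r : ℝ => circleMap 0 (r * (1 - (b - a))) ((a + b) / 2))
          (nhdsWithin (1 : ℝ) (Set.Iio 1)) (nhds p) := by
        have := hid.mul_const (1 - (b - a))
        rw [one_mul] at this
        exact (tendsto_circleMap_radius _).comp this
      have h2 := (hF'c.continuousAt (isOpen_ball.mem_nhds hpm)).tendsto.comp h1
      exact ((h2.norm.mul hid).mul_const (b - a)).div_const 2
    have hle := le_of_tendsto_of_tendsto hlow hchord (by
      filter_upwards [hIoo] with r hr
      exact (H a b hab hb r hr.1 hr.2).2)
    rw [heq, sub_self, norm_zero, hFg p hpm] at hle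
    have : 0 < ‖Complex.exp (g p)‖ * 1 * (b - a) / 2 := by
      have h1 : 0 < ‖Complex.exp (g p)‖ := norm_pos_iff.2 (Complex.exp_ne_zero _)
      have h2 : 0 < b - a := by linarith
      positivity
    linarith
  · by_contra hcon
    rw [not_le] at hcon
    obtain ⟨v, hv1, hv2⟩ := exists_between hcon
    have hev := eVariationOn.lowerSemicontinuous_aux
      (F := fun r s => F (circleMap 0 r s)) (p := nhdsWithin (1 : ℝ) (Set.Iio 1))
      (s := Set.Icc a b) (fun s _ => hlim s) hv2
    have hup : ∀ᶠ r in nhdsWithin (1 : ℝ) (Set.Iio 1),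
        v ≤ ENNReal.ofReal (3 * ‖F (circleMap 0 r b) - F (circleMap 0 r a)‖) := by
      filter_upwards [hev, hIoo] with r hr1 hr2
      refine hr1.le.trans ((eVariationOn_Icc_le_integral_norm_deriv
        (fun s => hasDerivAt_comp_circleMap hF hr2.1 hr2.2 s) ?_).trans
        (ENNReal.ofReal_le_ofReal (H a b hab hb r hr2.1 hr2.2).1))
      exact (hF'c.comp_continuous (continuous_circleMap 0 r)
        fun s => by simp [abs_of_pos hr2.1, hr2.2]).mul
        ((continuous_circleMap 0 r).mul continuous_const)
    exact absurd (ge_of_tendsto (ENNReal.tendsto_ofReal (hchord.const_mul 3)) hup) (not_le.2 hv1)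

theorem eq_of_continuous_of_mem_countable {E : Type*} [MetricSpace E] {S : Set E}
    (hS : S.Countable) {f : ℝ → E} (hf : Continuous f) (h : ∀ t, f t ∈ S) (s t : ℝ) : f s = f t :=
  hS.isTotallyDisconnected _ (Set.range_subset_iff.2 h) (isPreconnected_range hf) ⟨s, rfl⟩ ⟨t, rfl⟩

theorem exists_continuous_log {X : Type*} [TopologicalSpace X] [SimplyConnectedSpace X]
    [LocallyPathConnectedSpace X] {f : X → ℂ} (hf : Continuous f) (h0 : ∀ z, f z ≠ 0) :
    ∃ L : X → ℂ, Continuous L ∧ ∀ z, Complex.exp (L z) = f z := by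
  obtain ⟨x₀⟩ : Nonempty X := inferInstance
  obtain ⟨L, ⟨-, hL⟩, -⟩ := Complex.isCoveringMapOn_exp.existsUnique_continuousMap_lifts
    ⟨f, hf⟩ (a₀ := x₀) (Complex.exp_log (h0 x₀)) (fun x => h0 x)
  exact ⟨L, L.continuous, fun z => congrFun hL z⟩

theorem exists_int_of_exp_eq {f g : ℝ → ℂ} (hf : Continuous f) (hg : Continuous g)
    (h : ∀ t, Complex.exp (f t) = Complex.exp (g t)) :
    ∃ n : ℤ, ∀ t, f t - g t = n * (2 * π * Complex.I) := by
  have hex : ∀ t, ∃ n : ℤ, f t - g t = n * (2 * π * Complex.I) := fun t => by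
    obtain ⟨n, hn⟩ := Complex.exp_eq_exp_iff_exists_int.1 (h t)
    exact ⟨n, by rw [hn]; ring⟩
  obtain ⟨n, hn⟩ := hex 0
  refine ⟨n, fun t => ?_⟩
  rw [← hn]
  exact eq_of_continuous_of_mem_countable
    (Set.countable_range fun n : ℤ => (n : ℂ) * (2 * π * Complex.I)) (hf.sub hg)
    (fun t => (hex t).imp fun _ hn => hn.symm) t 0

theorem strictMono_or_strictAnti_of_locally_injective {f : ℝ → ℝ} (hf : Continuous f) {h : ℝ}
    (hh : 0 < h) (hinj : ∀ a b, a < b → b - a ≤ h → f a ≠ f b) : StrictMono f ∨ StrictAnti f := by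
  have key : ∀ f : ℝ → ℝ, Continuous f → (∀ a b, a < b → b - a ≤ h → f a ≠ f b) →
      (∀ t, f t < f (t + h)) → StrictMono f := by
    intro f hf hinj hpos
    have hloc : ∀ a b, a < b → b ≤ a + h → f a < f b := by
      intro a b hab hb
      refine hf.continuousOn.strictMonoOn_of_injOn_Icc (a := a) (b := a + h) (by linarith)
        (hpos a).le ?_ ⟨le_rfl, by linarith⟩ ⟨hab.le, hb⟩ hab
      intro x hx y hy hxy
      by_contra hne
      rcases lt_or_gt_of_ne hne with hlt | hlt
      · exact hinj x y hlt (by linarith [hx.1, hy.2]) hxy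
      · exact hinj y x hlt (by linarith [hy.1, hx.2]) hxy.symm
    have hstep : ∀ n : ℕ, ∀ a b, a < b → b ≤ a + n * h → f a < f b := by
      intro n
      induction n with
      | zero => intro a b hab hb; simp at hb; linarith
      | succ n ih =>
        intro a b hab hb
        rcases le_or_gt b (a + h) with hle | hgt
        · exact hloc a b hab hle
        · refine (hpos a).trans (ih _ _ hgt ?_)
          push_cast at hb
          linarith
    intro a b hab
    obtain ⟨n, hn⟩ := exists_nat_ge ((b - a) / h)
    rw [div_le_iff₀ hh] at hn
    exact hstep n a b hab (by linarith)
  have hne : ∀ t, f (t + h) - f t ≠ 0 := fun t =>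
    sub_ne_zero.2 (hinj t (t + h) (by linarith) (by linarith)).symm
  have hcont : Continuous fun t => f (t + h) - f t := by fun_prop
  have hsign : (∀ t, 0 < f (t + h) - f t) ∨ ∀ t, f (t + h) - f t < 0 := by
    by_contra! hcon
    obtain ⟨⟨s, hs⟩, t, ht⟩ := hcon
    obtain ⟨x, hx⟩ := mem_range_of_exists_le_of_exists_ge hcont ⟨s, hs⟩ ⟨t, ht⟩
    exact hne x hx
  rcases hsign with hs | hs
  · exact Or.inl (key f hf hinj fun t => by linarith [hs t])
  · have hk := key (fun t => -f t) hf.neg (fun a b hab hb => by simpa using hinj a b hab hb)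
      fun t => by linarith [hs t]
    exact Or.inr fun a b hab => by simpa using hk hab

theorem exists_int_eq_of_injOn_periodic {γ : ℝ → ℂ} (hγp : ∀ θ, γ (θ + 2 * π) = γ θ)
    (hγi : Set.InjOn γ (Set.Ico 0 (2 * π))) {x y : ℝ} (h : γ x = γ y) :
    ∃ n : ℤ, x - y = n * (2 * π) := by
  have hp : Function.Periodic γ (2 * π) := hγp
  have hpos : (0 : ℝ) < 2 * π := Real.two_pi_pos
  obtain ⟨m, hm, -⟩ := existsUnique_add_zsmul_mem_Ico hpos x 0
  obtain ⟨k, hk, -⟩ := existsUnique_add_zsmul_mem_Ico hpos y 0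
  rw [zero_add] at hm hk
  have := hγi hm hk (by rw [hp.zsmul m, hp.zsmul k, h])
  refine ⟨k - m, ?_⟩
  simp only [zsmul_eq_mul] at this
  push_cast
  linarith

/-- A continuous map into a Jordan curve lifts to the parameter line. -/
theorem exists_continuous_lift_of_range_subset {γ β : ℝ → ℂ} (hγc : Continuous γ)
    (hγp : ∀ θ, γ (θ + 2 * π) = γ θ) (hγi : Set.InjOn γ (Set.Ico 0 (2 * π)))
    (hβc : Continuous β) (hβ : ∀ t, β t ∈ Set.range γ) :
    ∃ θ : ℝ → ℝ, Continuous θ ∧ ∀ t, γ (θ t) = β t := by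
  have hp : Function.Periodic γ (2 * π) := hγp
  have : Fact ((0 : ℝ) < 2 * π) := ⟨Real.two_pi_pos⟩
  set G : AddCircle (2 * π) → ℂ := hp.lift with hG
  have hGcoe : ∀ x : ℝ, G (x : AddCircle (2 * π)) = γ x := fun x => hp.lift_coe x
  have hGc : Continuous G := by
    refine continuous_quot_lift _ hγc
  have hGi : Function.Injective G := by
    intro a b hab
    induction a using QuotientAddGroup.induction_on with | _ a
    induction b using QuotientAddGroup.induction_on with | _ b
    obtain ⟨n, hn⟩ := exists_int_eq_of_injOn_periodic hγp hγi (x := a) (y := b) (by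
      rw [← hGcoe, ← hGcoe]; exact hab)
    refine (QuotientAddGroup.eq_iff_sub_mem).2 ?_
    exact ⟨n, by simp [hn]⟩
  have hemb := (hGc.isClosedEmbedding hGi).isEmbedding
  have hβG : ∀ t, β t ∈ Set.range G := fun t => by
    obtain ⟨x, hx⟩ := hβ t
    exact ⟨x, (hGcoe x).trans hx⟩
  choose b hb using hβG
  have hbc : Continuous b := by
    rw [hemb.continuous_iff]
    exact hβc.congr fun t => (hb t).symm
  obtain ⟨x₀, hx₀⟩ := QuotientAddGroup.mk_surjective (b 0)
  obtain ⟨θ, ⟨-, hθ⟩, -⟩ := (AddCircle.isCoveringMap_coe (2 * π)).existsUnique_continuousMap_lifts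
    ⟨b, hbc⟩ 0 x₀ hx₀
  refine ⟨θ, θ.continuous, fun t => ?_⟩
  rw [← hGcoe, ← hb]
  exact congrArg G (congrFun hθ t)

theorem boundary_value_not_mem_image {F Φ : ℂ → ℂ} (hF : DifferentiableOn ℂ F (ball (0 : ℂ) 1))
    (hinj : Set.InjOn F (ball (0 : ℂ) 1)) (hΦ : ContinuousOn Φ (closedBall (0 : ℂ) 1))
    (hΦF : Set.EqOn Φ F (ball (0 : ℂ) 1)) (t : ℝ) :
    Φ (circleMap 0 1 t) ∉ F '' ball (0 : ℂ) 1 := by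
  rintro ⟨z, hz, hzt⟩
  have hz1 : ‖z‖ < 1 := by simpa using hz
  obtain ⟨ρ, hzρ, hρ⟩ := exists_between hz1
  have hmap : Filter.map F (nhds z) = nhds (F z) :=
    ((hF.analyticAt (isOpen_ball.mem_nhds hz)).hasStrictDerivAt).map_nhds_eq
      (deriv_ne_zero_of_injOn isOpen_ball hF hinj hz)
  have hnhds : F '' ball 0 ρ ∈ nhds (Φ (circleMap 0 1 t)) := by
    rw [← hzt, ← hmap]
    exact Filter.image_mem_map (isOpen_ball.mem_nhds (by simpa using hzρ))
  have hρ0 : 0 < ρ := (norm_nonneg z).trans_lt hzρ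
  obtain ⟨r, ⟨w, hw, hwr⟩, hr⟩ := (((tendsto_boundary_value hΦ hΦF t).eventually hnhds).and
    (Ioo_mem_nhdsLT hρ)).exists
  have hr0 : 0 < r := hρ0.trans hr.1
  have := hinj (ball_subset_ball hρ.le hw) (by simp [abs_of_pos hr0, hr.2]) hwr
  rw [this] at hw
  simp only [mem_ball_zero_iff, norm_circleMap_zero, abs_of_pos hr0] at hw
  linarith [hr.1]

/-- The Riemann map admits a continuous branch of `log (Φ - F 0)` along the unit circle, which
increases by `2πi` after one turn. -/
theorem exists_boundary_log {F Φ : ℂ → ℂ} (hF : DifferentiableOn ℂ F (ball (0 : ℂ) 1))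
    (hinj : Set.InjOn F (ball (0 : ℂ) 1)) (hΦ : ContinuousOn Φ (closedBall (0 : ℂ) 1))
    (hΦF : Set.EqOn Φ F (ball (0 : ℂ) 1)) :
    ∃ L : ℝ → ℂ, Continuous L ∧ (∀ t, Complex.exp (L t) = Φ (circleMap 0 1 t) - F 0) ∧
      ∀ t, L (t + 2 * π) = L t + 2 * π * Complex.I := by
  have h0 : (0 : ℂ) ∈ ball (0 : ℂ) 1 := by simp
  have hev : Φ =ᶠ[nhds 0] F := hΦF.eventuallyEq_of_mem (isOpen_ball.mem_nhds h0)
  have hd : DifferentiableAt ℂ Φ 0 :=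
    (hF.differentiableAt (isOpen_ball.mem_nhds h0)).congr_of_eventuallyEq hev
  have hq : ContinuousOn (dslope Φ 0) (closedBall (0 : ℂ) 1) :=
    (continuousOn_dslope (closedBall_mem_nhds 0 one_pos)).2 ⟨hΦ, hd⟩
  have hΦ0 : Φ 0 = F 0 := hΦF h0
  have hne : ∀ z ∈ closedBall (0 : ℂ) 1, dslope Φ 0 z ≠ 0 := by
    intro z hz
    by_cases hz0 : z = 0
    · rw [hz0, dslope_same, hev.deriv_eq]
      exact deriv_ne_zero_of_injOn isOpen_ball hF hinj h0
    rw [dslope_of_ne _ hz0, slope_def_field]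
    refine div_ne_zero (sub_ne_zero.2 ?_) (sub_ne_zero.2 hz0)
    rw [hΦ0]
    intro heq
    rcases (mem_closedBall_zero_iff.1 hz).lt_or_eq with hlt | h1
    · rw [hΦF (by simpa using hlt)] at heq
      exact hz0 (hinj (by simpa using hlt) h0 heq)
    · have hzc : z = circleMap 0 1 (Complex.arg z) := by
        conv_lhs => rw [← Complex.norm_mul_exp_arg_mul_I z, h1]
        simp [circleMap]
      exact boundary_value_not_mem_image hF hinj hΦ hΦF (Complex.arg z)
        ⟨0, h0, by rw [← hzc, heq]⟩
  have hret : ∀ z : ℂ, (z / (max 1 ‖z‖ : ℝ) : ℂ) ∈ closedBall (0 : ℂ) 1 := by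
    intro z
    have hm : 0 < max 1 ‖z‖ := one_pos.trans_le (le_max_left _ _)
    rw [mem_closedBall_zero_iff, norm_div, Complex.norm_real, Real.norm_of_nonneg hm.le,
      div_le_one hm]
    exact le_max_right _ _
  have hretc : Continuous fun z : ℂ => (z / (max 1 ‖z‖ : ℝ) : ℂ) := by
    refine continuous_id.div (by fun_prop) fun z => ?_
    exact_mod_cast (one_pos.trans_le (le_max_left 1 ‖z‖)).ne'
  obtain ⟨Q, hQ, hQe⟩ := exists_continuous_log
    (f := fun z => dslope Φ 0 (z / (max 1 ‖z‖ : ℝ))) (hq.comp_continuous hretc hret)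
    fun z => hne _ (hret z)
  refine ⟨fun t => t * Complex.I + Q (circleMap 0 1 t), ?_, fun t => ?_, fun t => ?_⟩
  · exact (by fun_prop : Continuous fun t : ℝ => (t : ℂ) * Complex.I).add
      (hQ.comp (continuous_circleMap 0 1))
  · have hn : circleMap 0 1 t ≠ 0 := circleMap_ne_center one_ne_zero
    rw [Complex.exp_add, hQe]
    simp only [norm_circleMap_zero, abs_one, max_self, Complex.ofReal_one, div_one]
    rw [dslope_of_ne _ hn, slope_def_field, hΦ0, sub_zero]
    have : Complex.exp (t * Complex.I) = circleMap 0 1 t := by simp [circleMap]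
    rw [this, mul_div_cancel₀ _ hn]
  · have : circleMap 0 1 (t + 2 * π) = circleMap 0 1 t := periodic_circleMap 0 1 t
    simp only [this]
    push_cast
    ring

theorem boundary_injOn_and_range {γ : ℝ → ℂ} (hγc : Continuous γ)
    (hγp : ∀ θ, γ (θ + 2 * π) = γ θ) (hγi : Set.InjOn γ (Set.Ico 0 (2 * π)))
    {F Φ : ℂ → ℂ} (hF : DifferentiableOn ℂ F (ball (0 : ℂ) 1))
    (hinj : Set.InjOn F (ball (0 : ℂ) 1)) (hΦ : ContinuousOn Φ (closedBall (0 : ℂ) 1))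
    (hΦF : Set.EqOn Φ F (ball (0 : ℂ) 1)) (hF0 : F 0 ∉ Set.range γ)
    (hβ : ∀ t, Φ (circleMap 0 1 t) ∈ Set.range γ) {h : ℝ} (hh : 0 < h)
    (hloc : ∀ a b, a < b → b - a ≤ h → Φ (circleMap 0 1 a) ≠ Φ (circleMap 0 1 b)) :
    Set.InjOn (fun t => Φ (circleMap 0 1 t)) (Set.Ico 0 (2 * π)) ∧
      Set.range (fun t => Φ (circleMap 0 1 t)) = Set.range γ := by
  have hβc : Continuous fun t => Φ (circleMap 0 1 t) :=
    hΦ.comp_continuous (continuous_circleMap 0 1) fun t => by simp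
  have hβp : ∀ t, Φ (circleMap 0 1 (t + 2 * π)) = Φ (circleMap 0 1 t) := fun t =>
    congrArg Φ (periodic_circleMap 0 1 t)
  obtain ⟨θ, hθc, hθ⟩ := exists_continuous_lift_of_range_subset hγc hγp hγi hβc hβ
  obtain ⟨L, hLc, hLe, hLp⟩ := exists_boundary_log hF hinj hΦ hΦF
  obtain ⟨M, hMc, hMe⟩ := exists_continuous_log (f := fun s => γ s - F 0)
    (hγc.sub continuous_const)
    fun s => sub_ne_zero.2 fun hs => hF0 ⟨s, hs⟩
  obtain ⟨n, hn⟩ := exists_int_of_exp_eq (f := fun s => M (s + 2 * π)) (g := M)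
    (by fun_prop) hMc fun s => by rw [hMe, hMe, hγp]
  obtain ⟨k, hk⟩ := exists_int_of_exp_eq (f := fun t => M (θ t)) (g := L)
    (hMc.comp hθc) hLc fun t => by rw [hMe, hLe, hθ]
  have hπ : (0 : ℝ) < 2 * π := Real.two_pi_pos
  have hdex : ∀ t, ∃ d : ℤ, θ (t + 2 * π) - θ t = d * (2 * π) := fun t =>
    exists_int_eq_of_injOn_periodic hγp hγi (by rw [hθ, hθ, hβp])
  obtain ⟨d, hd⟩ : ∃ d : ℤ, ∀ t, θ (t + 2 * π) - θ t = d * (2 * π) := by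
    obtain ⟨d, hd⟩ := hdex 0
    refine ⟨d, fun t => ?_⟩
    rw [← hd]
    exact eq_of_continuous_of_mem_countable
      (Set.countable_range fun n : ℤ => (n : ℝ) * (2 * π))
      ((hθc.comp (by fun_prop : Continuous fun t : ℝ => t + 2 * π)).sub hθc)
      (fun t => (hdex t).imp fun _ hn => hn.symm) t 0
  have hMper : ∀ (s : ℝ) (m : ℤ), M (s + m * (2 * π)) = M s + m * (n * (2 * π * Complex.I)) := by
    have hMn : ∀ (m : ℕ) (s : ℝ), M (s + m * (2 * π)) = M s + m * (n * (2 * π * Complex.I)) := by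
      intro m
      induction m with
      | zero => simp
      | succ m ih =>
        intro s
        have h1 := hn (s + m * (2 * π))
        have h2 := ih s
        have h3 : s + (m + 1 : ℕ) * (2 * π) = s + m * (2 * π) + 2 * π := by push_cast; ring
        rw [h3]
        push_cast
        linear_combination h1 + h2
    intro s m
    obtain ⟨j, rfl | rfl⟩ := m.eq_nat_or_neg
    · exact_mod_cast hMn j s
    · have := hMn j (s + (-(j : ℤ) : ℤ) * (2 * π))
      push_cast at this ⊢
      rw [show s + -(j : ℝ) * (2 * π) + j * (2 * π) = s by ring] at this
      rw [this]
      ring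
  have hnd : d * n = 1 := by
    have h1 := hk (0 + 2 * π)
    have h2 := hk 0
    have h3 := hd 0
    rw [show θ (0 + 2 * π) = θ 0 + d * (2 * π) by linarith, hMper, hLp] at h1
    have h4 : ((d * n : ℤ) : ℂ) * (2 * π * Complex.I) = 1 * (2 * π * Complex.I) := by
      push_cast
      linear_combination h1 - h2
    have := mul_right_cancel₀ Complex.two_pi_I_ne_zero h4
    exact_mod_cast this
  have habs : |(d : ℝ)| = 1 := by
    rcases Int.isUnit_iff.1 (IsUnit.of_mul_eq_one _ hnd) with h | h <;> simp [h]
  have hmono := strictMono_or_strictAnti_of_locally_injective hθc hh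
    fun a b hab hb heq => hloc a b hab hb (by rw [← hθ, ← hθ, heq])
  have hθi : Function.Injective θ := hmono.elim StrictMono.injective StrictAnti.injective
  have hbd : |θ (0 + 2 * π) - θ 0| = 2 * π := by rw [hd, abs_mul, habs, one_mul, abs_of_pos hπ]
  have hlt : ∀ a b, a < b → b < a + 2 * π → |θ b - θ a| < 2 * π := by
    intro a b hab hb
    have hda : |θ (a + 2 * π) - θ a| = 2 * π := by rw [hd, abs_mul, habs, one_mul, abs_of_pos hπ]
    rcases hmono with hm | hm
    · have h1 := hm hab
      have h2 := hm hb
      rw [abs_of_pos (by linarith)] at hda ⊢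
      linarith
    · have h1 := hm hab
      have h2 := hm hb
      rw [abs_of_neg (by linarith)] at hda ⊢
      linarith
  have hnot : ∀ a b, a < b → b < a + 2 * π → Φ (circleMap 0 1 a) ≠ Φ (circleMap 0 1 b) := by
    intro a b hab hb heq
    obtain ⟨m, hm⟩ := exists_int_eq_of_injOn_periodic hγp hγi (x := θ b) (y := θ a)
      (by rw [hθ, hθ, heq])
    have h1 := hlt a b hab hb
    rw [hm, abs_mul, abs_of_pos hπ] at h1
    have h2 : |(m : ℝ)| < 1 := by
      by_contra! hcon
      nlinarith
    have h3 : m = 0 := Int.abs_lt_one_iff.1 (by exact_mod_cast h2)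
    rw [h3] at hm
    simp only [Int.cast_zero, zero_mul] at hm
    exact hab.ne' (hθi (sub_eq_zero.1 hm))
  refine ⟨fun a ha b hb hab => ?_, Set.Subset.antisymm (Set.range_subset_iff.2 hβ) ?_⟩
  · by_contra hne
    rcases lt_or_gt_of_ne hne with hlt | hlt
    · exact hnot a b hlt (by linarith [ha.1, hb.2]) hab
    · exact hnot b a hlt (by linarith [hb.1, ha.2]) hab.symm
  · rintro _ ⟨x, rfl⟩
    have hp : Function.Periodic γ (2 * π) := hγp
    obtain ⟨m, hm, -⟩ := existsUnique_add_zsmul_mem_Ico hπ x (min (θ 0) (θ (0 + 2 * π)))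
    have hmem : x + m • (2 * π) ∈ Set.uIcc (θ 0) (θ (0 + 2 * π)) := by
      refine ⟨hm.1, hm.2.le.trans ?_⟩
      have := max_sub_min_eq_abs (θ 0) (θ (0 + 2 * π))
      rw [hbd] at this
      change _ ≤ max _ _
      linarith
    obtain ⟨t, -, ht⟩ := intermediate_value_uIcc hθc.continuousOn hmem
    exact ⟨t, by simp only [← hθ, ht, hp.zsmul m x]⟩

theorem LipschitzWith.intervalIntegrable_norm_deriv {w : ℝ → ℂ} {c : NNReal}
    (hw : LipschitzWith c w) (x y : ℝ) :
    IntervalIntegrable (fun s => ‖deriv w s‖) volume x y := by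
  refine (intervalIntegrable_const (c := (c : ℝ))).mono_fun
    (measurable_deriv w).norm.aestronglyMeasurable (Filter.Eventually.of_forall fun s => ?_)
  simpa using norm_deriv_le_of_lipschitz hw

theorem LipschitzWith.norm_sub_le_integral_norm_deriv {w : ℝ → ℂ} {c : NNReal}
    (hw : LipschitzWith c w) {x y : ℝ} (hxy : x ≤ y) :
    ‖w y - w x‖ ≤ ∫ s in x..y, ‖deriv w s‖ := by
  set u : ℂ := w y - w x with hu
  rcases eq_or_ne u 0 with h0 | h0
  · rw [h0, norm_zero]
    exact intervalIntegral.integral_nonneg hxy fun _ _ => norm_nonneg _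
  have hu0 : 0 < ‖u‖ := norm_pos_iff.2 h0
  set T : ℂ →L[ℝ] ℝ := innerSL ℝ u with hT
  have hTnorm : ∀ z, T z ≤ ‖u‖ * ‖z‖ := fun z => real_inner_le_norm u z
  have hTw : LipschitzWith (‖T‖₊ * c) (T ∘ w) := T.lipschitz.comp hw
  have hac := (hTw.lipschitzOnWith (s := Set.uIcc x y)).absolutelyContinuousOnInterval
  have h_int := hac.integral_deriv_eq_sub
  have hTu : T (w y) - T (w x) = ‖u‖ * ‖u‖ := by
    rw [← map_sub, ← hu]
    exact real_inner_self_eq_norm_mul_norm u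
  have hbT : ∀ s, ‖deriv (T ∘ w) s‖ ≤ (‖T‖₊ * c : NNReal) := fun s => norm_deriv_le_of_lipschitz hTw
  have hle : ∫ s in x..y, deriv (T ∘ w) s ≤ ∫ s in x..y, ‖u‖ * ‖deriv w s‖ := by
    refine intervalIntegral.integral_mono_ae hxy ?_ ?_ ?_
    · refine (intervalIntegrable_const (c := ((‖T‖₊ * c : NNReal) : ℝ))).mono_fun
        (measurable_deriv _).aestronglyMeasurable (Filter.Eventually.of_forall fun s => ?_)
      rw [Real.norm_of_nonneg (NNReal.coe_nonneg _)]
      exact hbT s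
    · exact (hw.intervalIntegrable_norm_deriv x y).const_mul _
    · filter_upwards [hw.ae_differentiableAt (μ := volume)] with s hs
      rw [(T.hasFDerivAt.comp_hasDerivAt s hs.hasDerivAt).deriv]
      exact hTnorm _
  rw [h_int, intervalIntegral.integral_const_mul] at hle
  simp only [Function.comp_apply] at hle
  rw [hTu] at hle
  exact le_of_mul_le_mul_left hle hu0

/-- A Lipschitz curve whose length over each interval is the Lipschitz constant times the length of
the interval has constant speed almost everywhere. -/
theorem LipschitzWith.ae_hasDerivAt_norm_eq {w : ℝ → ℂ} {c : NNReal} (hw : LipschitzWith c w)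
    (hvar : ∀ a b, a ≤ b → ENNReal.ofReal (c * (b - a)) ≤ eVariationOn w (Set.Icc a b)) :
    ∀ᵐ θ : ℝ, ∃ v : ℂ, HasDerivAt w v θ ∧ ‖v‖ = c := by
  have hbd : ∀ s, ‖deriv w s‖ ≤ c := fun s => norm_deriv_le_of_lipschitz hw
  have h_int := hw.intervalIntegrable_norm_deriv
  have hloc : ∀ n : ℕ, ∀ᵐ θ : ℝ, θ ∈ Set.Ioc (-(n : ℝ)) n → ‖deriv w θ‖ = c := by
    intro n
    have hn : -(n : ℝ) ≤ n := by linarith [(n.cast_nonneg : (0 : ℝ) ≤ n)]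
    have h1 : c * ((n : ℝ) - -(n : ℝ)) ≤ ∫ s in (-(n : ℝ))..n, ‖deriv w s‖ := by
      have := (hvar _ _ hn).trans (eVariationOn_Icc_le_integral (fun _ => norm_nonneg _) h_int
        fun x y hxy => hw.norm_sub_le_integral_norm_deriv hxy)
      exact (ENNReal.ofReal_le_ofReal_iff
        (intervalIntegral.integral_nonneg hn fun _ _ => norm_nonneg _)).1 this
    have h2 : ∫ s in (-(n : ℝ))..n, ((c : ℝ) - ‖deriv w s‖) = 0 := by
      refine le_antisymm ?_ (intervalIntegral.integral_nonneg hn fun s _ => sub_nonneg.2 (hbd s))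
      rw [intervalIntegral.integral_sub intervalIntegrable_const (h_int _ _),
        intervalIntegral.integral_const, smul_eq_mul]
      linarith
    rw [intervalIntegral.integral_eq_zero_iff_of_nonneg_ae
      (Filter.Eventually.of_forall fun s => sub_nonneg.2 (hbd s))
      (intervalIntegrable_const.sub (h_int _ _)), Filter.EventuallyEq,
      MeasureTheory.ae_restrict_iff' (measurableSet_Ioc.union measurableSet_Ioc)] at h2
    filter_upwards [h2] with θ hθ hmem
    have := hθ (Or.inl hmem)
    simp only [Pi.zero_apply] at this
    linarith
  filter_upwards [hw.ae_differentiableAt (μ := volume), ae_all_iff.2 hloc] with θ hd hθ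
  refine ⟨deriv w θ, hd.hasDerivAt, ?_⟩
  obtain ⟨n, hn⟩ := exists_nat_gt |θ|
  exact hθ n ⟨(abs_lt.1 hn).1, (abs_lt.1 hn).2.le⟩

theorem locallyBoundedVariationOn_of_short_arcs {β : ℝ → ℂ} {h : ℝ} (hh : 0 < h)
    (H : ∀ a b, a < b → b - a ≤ h →
      eVariationOn β (Set.Icc a b) ≤ ENNReal.ofReal (3 * ‖β b - β a‖)) :
    LocallyBoundedVariationOn β Set.univ := by
  have hstep : ∀ n : ℕ, ∀ a b, a ≤ b → b ≤ a + n * h → eVariationOn β (Set.Icc a b) ≠ ⊤ := by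
    intro n
    induction n with
    | zero =>
      intro a b hab hb
      have : a = b := by simp at hb; linarith
      rw [this, Set.Icc_self, eVariationOn.subsingleton _ Set.subsingleton_singleton]
      exact ENNReal.zero_ne_top
    | succ n ih =>
      intro a b hab hb
      rcases le_or_gt b (a + h) with hle | hgt
      · rcases hab.eq_or_lt with rfl | hlt
        · exact ih _ _ le_rfl (by nlinarith [(n.cast_nonneg : (0 : ℝ) ≤ n)])
        · exact ((H a b hlt (by linarith)).trans_lt ENNReal.ofReal_lt_top).ne
      · have h1 := eVariationOn.Icc_add_Icc β (s := Set.univ) (a := a) (b := a + h) (c := b)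
          (by linarith) hgt.le (Set.mem_univ _)
        simp only [Set.univ_inter] at h1
        rw [← h1]
        refine ENNReal.add_ne_top.2 ⟨((H a _ (by linarith) (by linarith)).trans_lt
          ENNReal.ofReal_lt_top).ne, ih _ _ hgt.le ?_⟩
        push_cast at hb
        linarith
  intro a b _ _
  unfold BoundedVariationOn
  rw [Set.univ_inter]
  rcases le_or_gt a b with hab | hab
  · obtain ⟨n, hn⟩ := exists_nat_ge ((b - a) / h)
    rw [div_le_iff₀ hh] at hn
    exact hstep n a b hab (by linarith)
  · rw [Set.Icc_eq_empty hab.not_ge, eVariationOn.subsingleton _ Set.subsingleton_empty]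
    exact ENNReal.zero_ne_top

/-- The arc-length function of a closed Jordan curve whose short arcs have length comparable to
their chord. -/
theorem exists_arc_length_orderIso {β : ℝ → ℂ} (hβc : Continuous β)
    (hβp : ∀ t, β (t + 2 * π) = β t) (hβi : Set.InjOn β (Set.Ico 0 (2 * π))) {h : ℝ} (hh : 0 < h)
    (H : ∀ a b, a < b → b - a ≤ h →
      eVariationOn β (Set.Icc a b) ≤ ENNReal.ofReal (3 * ‖β b - β a‖)) :
    ∃ (ℓ : ℝ) (S : ℝ ≃o ℝ), 0 < ℓ ∧ S 0 = 0 ∧ (∀ t, S (t + 2 * π) = S t + ℓ) ∧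
      (∀ a b, a ≤ b → eVariationOn β (Set.Icc a b) = ENNReal.ofReal (S b - S a)) ∧
      (∀ a b, a ≤ b → ‖β b - β a‖ ≤ S b - S a) ∧
      ∀ a b, a < b → b - a ≤ h → S b - S a ≤ 3 * ‖β b - β a‖ := by
  have hbv := locallyBoundedVariationOn_of_short_arcs hh H
  have hπ : (0 : ℝ) < 2 * π := Real.two_pi_pos
  set S : ℝ → ℝ := variationOnFromTo β Set.univ 0 with hS
  have hdiff : ∀ a b, a ≤ b → S b - S a = (eVariationOn β (Set.Icc a b)).toReal := by
    intro a b hab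
    have h1 := variationOnFromTo.add hbv (Set.mem_univ 0) (Set.mem_univ a) (Set.mem_univ b)
    rw [variationOnFromTo.eq_of_le _ _ hab, Set.univ_inter] at h1
    simp only [hS]
    linarith
  have hfin : ∀ a b, eVariationOn β (Set.Icc a b) ≠ ⊤ := fun a b => by
    have := hbv a b (Set.mem_univ _) (Set.mem_univ _)
    rwa [BoundedVariationOn, Set.univ_inter] at this
  have hvar : ∀ a b, a ≤ b → eVariationOn β (Set.Icc a b) = ENNReal.ofReal (S b - S a) := by
    intro a b hab
    rw [hdiff a b hab, ENNReal.ofReal_toReal (hfin a b)]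
  have hlow : ∀ a b, a ≤ b → ‖β b - β a‖ ≤ S b - S a := by
    intro a b hab
    rw [hdiff a b hab, ← dist_eq_norm, dist_edist]
    exact ENNReal.toReal_mono (hfin a b)
      (eVariationOn.edist_le β (Set.right_mem_Icc.2 hab) (Set.left_mem_Icc.2 hab))
  have hup : ∀ a b, a < b → b - a ≤ h → S b - S a ≤ 3 * ‖β b - β a‖ := by
    intro a b hab hb
    rw [hdiff a b hab.le]
    exact ENNReal.toReal_le_of_le_ofReal (by positivity) (H a b hab hb)
  have hmono' : Monotone S := fun a b hab => by linarith [hlow a b hab, norm_nonneg (β b - β a)]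
  have hmono : StrictMono S := by
    intro a b hab
    set b' := min b (a + π) with hb'
    have h1 : a < b' := lt_min hab (by linarith [Real.pi_pos])
    have h2 : b' ≤ a + π := min_le_right _ _
    have hne : β b' ≠ β a := by
      intro heq
      obtain ⟨n, hn⟩ := exists_int_eq_of_injOn_periodic hβp hβi heq
      have h3 : (0 : ℝ) < n := by
        by_contra! hcon
        nlinarith
      have h4 : (n : ℝ) < 1 := by
        by_contra! hcon
        nlinarith [Real.pi_pos]
      have h5 : 0 < n := by exact_mod_cast h3
      have h6 : n < 1 := by exact_mod_cast h4
      omega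
    have := norm_pos_iff.2 (sub_ne_zero.2 hne)
    linarith [hlow a b' h1.le, hmono' (min_le_left b (a + π))]
  have hcont : Continuous S := by
    rw [continuous_iff_continuousAt]
    intro t
    have hlim : Filter.Tendsto (fun s => 3 * ‖β s - β t‖) (nhds t) (nhds 0) := by
      have : Continuous fun s => 3 * ‖β s - β t‖ := by fun_prop
      simpa using this.tendsto t
    refine tendsto_iff_norm_sub_tendsto_zero.2 (squeeze_zero' (Filter.Eventually.of_forall
      fun _ => norm_nonneg _) ?_ hlim)
    filter_upwards [Metric.ball_mem_nhds t hh] with s hs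
    rw [Metric.mem_ball, Real.dist_eq, abs_lt] at hs
    rcases lt_trichotomy s t with hst | rfl | hst
    · rw [Real.norm_of_nonpos (sub_nonpos.2 (hmono' hst.le)), norm_sub_rev]
      linarith [hup s t hst (by linarith)]
    · simp
    · rw [Real.norm_of_nonneg (sub_nonneg.2 (hmono' hst.le))]
      exact hup t s hst (by linarith)
  have hS0 : S 0 = 0 := variationOnFromTo.self _ _ _
  have hshift : ∀ a b, a ≤ b → S (b + 2 * π) - S (a + 2 * π) = S b - S a := by
    intro a b hab
    rw [hdiff _ _ (by linarith), hdiff _ _ hab, ← Set.image_add_const_Icc,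
      ← eVariationOn.comp_eq_of_monotoneOn β (fun t => t + 2 * π)
        (fun x _ y _ hxy => by simpa using hxy)]
    congr 2
    funext t
    exact hβp t
  have hper : ∀ t, S (t + 2 * π) = S t + S (2 * π) := by
    intro t
    rcases le_total 0 t with ht | ht
    · have := hshift 0 t ht
      rw [zero_add] at this
      linarith
    · have := hshift t 0 ht
      rw [zero_add] at this
      linarith
  have hℓ : 0 < S (2 * π) := by
    have := hmono hπ
    rwa [hS0] at this
  have hnat : ∀ n : ℕ, S (n * (2 * π)) = n * S (2 * π) ∧ S (-(n * (2 * π))) = -(n * S (2 * π)) := by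
    intro n
    induction n with
    | zero => simp [hS0]
    | succ n ih =>
      have h1 := hper (n * (2 * π))
      have h2 := hper (-((n + 1 : ℕ) * (2 * π)))
      rw [show -((n + 1 : ℕ) * (2 * π)) + 2 * π = -(n * (2 * π)) by push_cast; ring] at h2
      rw [show (n : ℝ) * (2 * π) + 2 * π = (n + 1 : ℕ) * (2 * π) by push_cast; ring] at h1
      rw [h1, ih.1]
      push_cast at h2 ⊢
      constructor
      · ring
      · linarith [ih.2]
  have hsurj : Function.Surjective S := by
    intro y
    obtain ⟨n, hn⟩ := exists_nat_ge (|y| / S (2 * π))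
    rw [div_le_iff₀ hℓ] at hn
    exact mem_range_of_exists_le_of_exists_ge hcont
      ⟨-(n * (2 * π)), by rw [(hnat n).2]; linarith [(abs_le.1 hn).1]⟩
      ⟨n * (2 * π), by rw [(hnat n).1]; exact (le_abs_self y).trans hn⟩
  exact ⟨S (2 * π), StrictMono.orderIsoOfSurjective S hmono hsurj, hℓ, hS0, hper, hvar, hlow, hup⟩

theorem chord_arc_of_arc_length {β : ℝ → ℂ} (hβc : Continuous β)
    (hβp : ∀ t, β (t + 2 * π) = β t) (hβi : Set.InjOn β (Set.Ico 0 (2 * π))) {h : ℝ} (hh : 0 < h)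
    {ℓ : ℝ} (hℓ : 0 < ℓ) {S : ℝ ≃o ℝ} (hper : ∀ t, S (t + 2 * π) = S t + ℓ)
    (hup : ∀ a b, a < b → b - a ≤ h → S b - S a ≤ 3 * ‖β b - β a‖) :
    ∃ C : ℝ, 0 < C ∧ ∀ a ∈ Set.Icc 0 (2 * π), ∀ b ∈ Set.Icc 0 (2 * π), a ≤ b →
      min (S b - S a) (ℓ - (S b - S a)) ≤ C * ‖β a - β b‖ := by
  set K : Set (ℝ × ℝ) := (Set.Icc 0 (2 * π) ×ˢ Set.Icc 0 (2 * π)) ∩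
    {p | h ≤ p.2 - p.1 ∧ p.2 - p.1 ≤ 2 * π - h} with hK
  have hKc : IsCompact K := by
    refine (isCompact_Icc.prod isCompact_Icc).inter_right ?_
    exact (isClosed_le continuous_const (continuous_snd.sub continuous_fst)).inter
      (isClosed_le (continuous_snd.sub continuous_fst) continuous_const)
  have hβK : ContinuousOn (fun p : ℝ × ℝ => ‖β p.1 - β p.2‖) K := by fun_prop
  obtain ⟨m, hm, hmK⟩ := hKc.exists_forall_le' hβK (a := 0) (by
    rintro ⟨a, b⟩ ⟨-, h1, h2⟩
    refine norm_pos_iff.2 (sub_ne_zero.2 fun heq => ?_)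
    obtain ⟨n, hn⟩ := exists_int_eq_of_injOn_periodic hβp hβi heq.symm
    simp only at h1 h2
    have h3 : (0 : ℝ) < n := by
      by_contra! hcon
      nlinarith [Real.pi_pos]
    have h4 : (n : ℝ) < 1 := by
      by_contra! hcon
      nlinarith [Real.pi_pos]
    have h5 : 0 < n := by exact_mod_cast h3
    have h6 : n < 1 := by exact_mod_cast h4
    omega)
  refine ⟨3 + ℓ / m, by positivity, fun a ha b hb hab => ?_⟩
  have hq : 0 ≤ ℓ / m * ‖β a - β b‖ := by positivity
  have hnn := norm_nonneg (β a - β b)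
  rw [add_mul]
  by_cases h1 : b - a ≤ h
  · rcases hab.eq_or_lt with rfl | hlt
    · simp
    · refine (min_le_left _ _).trans ?_
      have := hup a b hlt h1
      rw [norm_sub_rev] at this
      linarith
  · by_cases h2 : b - a ≤ 2 * π - h
    · have h3 := hmK (a, b) ⟨⟨ha, hb⟩, by simp only; linarith, h2⟩
      have h4 : ℓ ≤ ℓ / m * ‖β a - β b‖ := by
        rw [div_mul_eq_mul_div, le_div_iff₀ hm]
        exact mul_le_mul_of_nonneg_left h3 hℓ.le
      refine (min_le_right _ _).trans ?_
      have := S.monotone hab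
      linarith
    · refine (min_le_right _ _).trans ?_
      have hle : b ≤ a + 2 * π := by linarith [ha.1, hb.2]
      rcases hle.eq_or_lt with heq | hlt
      · have := hper a
        rw [← heq] at this
        linarith
      · have := hup b (a + 2 * π) hlt (by linarith)
        rw [hper, hβp] at this
        linarith

/-- Arc-length reparametrization of a closed Jordan curve whose short arcs have length comparable to
their chord. -/
theorem exists_arc_length_parametrization {β : ℝ → ℂ} (hβc : Continuous β)
    (hβp : ∀ t, β (t + 2 * π) = β t) (hβi : Set.InjOn β (Set.Ico 0 (2 * π))) {h : ℝ} (hh : 0 < h)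
    (H : ∀ a b, a < b → b - a ≤ h →
      eVariationOn β (Set.Icc a b) ≤ ENNReal.ofReal (3 * ‖β b - β a‖)) :
    ∃ ℓ : ℝ, 0 < ℓ ∧ ∃ w : ℝ → ℂ,
      LipschitzWith (Real.toNNReal (ℓ / (2 * π))) w ∧
      (∀ θ, w (θ + 2 * π) = w θ) ∧
      Set.InjOn w (Set.Ico 0 (2 * π)) ∧
      Set.range w = Set.range β ∧
      (∀ᵐ θ : ℝ, ∃ v : ℂ, HasDerivAt w v θ ∧ ‖v‖ = ℓ / (2 * π)) ∧
      ∃ C : ℝ, 0 < C ∧ ∀ θ ∈ Set.Icc (0 : ℝ) (2 * π), ∀ σ ∈ Set.Icc (0 : ℝ) (2 * π),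
        (ℓ / (2 * π)) * min |θ - σ| (2 * π - |θ - σ|) ≤ C * ‖w θ - w σ‖ := by
  obtain ⟨ℓ, S, hℓ, hS0, hper, hvar, hlow, hup⟩ := exists_arc_length_orderIso hβc hβp hβi hh H
  obtain ⟨C, hC, hCS⟩ := chord_arc_of_arc_length hβc hβp hβi hh hℓ hper hup
  have hπ : (0 : ℝ) < 2 * π := Real.two_pi_pos
  set c : ℝ := ℓ / (2 * π) with hc
  have hc0 : 0 < c := div_pos hℓ hπ
  have hcℓ : c * (2 * π) = ℓ := div_mul_cancel₀ _ hπ.ne'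
  set T : ℝ ≃o ℝ := (OrderIso.mulLeft₀ c hc0).trans S.symm with hT
  have hST : ∀ θ, S (T θ) = c * θ := fun θ => by simp [hT]
  have hT0 : T 0 = 0 := S.injective (by rw [hST, hS0, mul_zero])
  have hTper : ∀ θ, T (θ + 2 * π) = T θ + 2 * π := fun θ =>
    S.injective (by rw [hST, hper, hST, mul_add, hcℓ])
  have hT1 : T (2 * π) = 2 * π := by simpa [hT0] using hTper 0
  have hcc : ((Real.toNNReal c : NNReal) : ℝ) = c := Real.coe_toNNReal _ hc0.le
  have hlip : LipschitzWith (Real.toNNReal c) (β ∘ T) := by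
    refine LipschitzWith.of_dist_le_mul fun x y => ?_
    rw [hcc]
    wlog hxy : y ≤ x generalizing x y
    · rw [dist_comm, dist_comm x]
      exact this y x (le_of_not_ge hxy)
    rw [dist_eq_norm, Real.dist_eq, abs_of_nonneg (sub_nonneg.2 hxy), mul_sub, ← hST, ← hST]
    exact hlow _ _ (T.monotone hxy)
  refine ⟨ℓ, hℓ, β ∘ T, hlip, fun θ => ?_, ?_, T.surjective.range_comp β, ?_, C, hC, ?_⟩
  · simp only [Function.comp_apply, hTper, hβp]
  · refine hβi.comp T.injective.injOn fun x hx => ⟨?_, ?_⟩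
    · rw [← hT0]
      exact T.monotone hx.1
    · rw [← hT1]
      exact T.strictMono hx.2
  · have := hlip.ae_hasDerivAt_norm_eq fun a b hab => by
      rw [eVariationOn.comp_eq_of_monotoneOn β T (T.monotone.monotoneOn _), OrderIso.image_Icc,
        hvar _ _ (T.monotone hab), hST, hST, hcc, mul_sub]
    rwa [hcc] at this
  · intro θ hθ σ hσ
    wlog hle : θ ≤ σ generalizing θ σ
    · rw [abs_sub_comm, norm_sub_rev]
      exact this σ hσ θ hθ (le_of_not_ge hle)
    have hmem : ∀ x ∈ Set.Icc 0 (2 * π), T x ∈ Set.Icc 0 (2 * π) := fun x hx =>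
      ⟨by rw [← hT0]; exact T.monotone hx.1, by rw [← hT1]; exact T.monotone hx.2⟩
    have := hCS _ (hmem θ hθ) _ (hmem σ hσ) (T.monotone hle)
    rw [hST, hST] at this
    rw [abs_sub_comm, abs_of_nonneg (sub_nonneg.2 hle), mul_min_of_nonneg _ _ hc0.le, mul_sub,
      mul_sub c (2 * π), hcℓ, mul_sub]
    exact this

/-- Boundary values of a Riemann map lie on the boundary curve. -/
theorem boundary_value_mem_range {γ : ℝ → ℂ} {Ω Ωstar : Set ℂ} (hΩso : IsOpen Ωstar)
    (hdisj : Disjoint Ω Ωstar) (hunion : Ω ∪ Ωstar = (Set.range γ)ᶜ) {F Φ : ℂ → ℂ}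
    (hF : DifferentiableOn ℂ F (ball (0 : ℂ) 1)) (hFbij : Set.BijOn F (ball (0 : ℂ) 1) Ω)
    (hΦ : ContinuousOn Φ (closedBall (0 : ℂ) 1)) (hΦF : Set.EqOn Φ F (ball (0 : ℂ) 1)) (t : ℝ) :
    Φ (circleMap 0 1 t) ∈ Set.range γ := by
  by_contra hcon
  rw [← Set.mem_compl_iff, ← hunion] at hcon
  rcases hcon with hmem | hmem
  · rw [← hFbij.image_eq] at hmem
    exact boundary_value_not_mem_image hF hFbij.injOn hΦ hΦF t hmem
  · obtain ⟨r, hr, hr1⟩ := (((tendsto_boundary_value hΦ hΦF t).eventually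
      (hΩso.mem_nhds hmem)).and (Ioo_mem_nhdsLT one_pos)).exists
    exact Set.disjoint_left.1 hdisj
      (hFbij.mapsTo (by simp [abs_of_pos hr1.1, hr1.2])) hr

theorem wp_quasicircle_is_chordarc
    -- the Jordan curve `Γ = range γ`, parametrized `2π`-periodically and injectively
    (γ : ℝ → ℂ) (hγc : Continuous γ) (hγp : ∀ θ, γ (θ + 2 * π) = γ θ)
    (hγi : Set.InjOn γ (Set.Ico 0 (2 * π)))
    -- `Γ` is a quasicircle: Ahlfors' bounded turning condition
    (hqc : ∃ C : ℝ, 0 < C ∧ ∀ s t : ℝ, s ≤ t → t ≤ s + 2 * π →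
      min (Metric.diam (γ '' Set.Icc s t)) (Metric.diam (γ '' Set.Icc t (s + 2 * π)))
        ≤ C * ‖γ s - γ t‖)
    -- interior `Ω` and exterior `Ωstar`
    (Ω Ωstar : Set ℂ)
    (hΩo : IsOpen Ω) (hΩconn : IsConnected Ω) (hΩso : IsOpen Ωstar)
    (hΩsconn : IsConnected Ωstar) (hdisj : Disjoint Ω Ωstar)
    (hunion : Ω ∪ Ωstar = (Set.range γ)ᶜ)
    (hΩbdd : Bornology.IsBounded Ω) (hΩsunbdd : ¬ Bornology.IsBounded Ωstar)
    -- the interior Riemann map `F : 𝔻 → Ω`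
    (F : ℂ → ℂ) (hF : DifferentiableOn ℂ F (ball (0 : ℂ) 1))
    (hFbij : Set.BijOn F (ball (0 : ℂ) 1) Ω)
    -- `Γ` is a Weil–Petersson quasicircle
    (hWP : (∫⁻ z in ball (0 : ℂ) 1,
        ENNReal.ofReal (‖deriv (deriv F) z / deriv F z‖ ^ 2)) < ⊤) :
    -- `Γ` is rectifiable, with arclength parametrization `w` and length `ℓ`, and chord-arc
    ∃ ℓ : ℝ, 0 < ℓ ∧ ∃ w : ℝ → ℂ,
      LipschitzWith (Real.toNNReal (ℓ / (2 * π))) w ∧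
      (∀ θ, w (θ + 2 * π) = w θ) ∧
      Set.InjOn w (Set.Ico 0 (2 * π)) ∧
      Set.range w = Set.range γ ∧
      (∀ᵐ θ : ℝ, ∃ v : ℂ, HasDerivAt w v θ ∧ ‖v‖ = ℓ / (2 * π)) ∧
      ∃ C : ℝ, 0 < C ∧ ∀ θ ∈ Set.Icc (0 : ℝ) (2 * π), ∀ σ ∈ Set.Icc (0 : ℝ) (2 * π),
        (ℓ / (2 * π)) * min |θ - σ| (2 * π - |θ - σ|) ≤ C * ‖w θ - w σ‖ := by
  have hinj := hFbij.injOn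
  obtain ⟨g, hg, hFg, hg'⟩ := exists_log_deriv hF hinj
  have hD : ∫⁻ z in ball (0 : ℂ) 1, ENNReal.ofReal (‖deriv g z‖ ^ 2) < ⊤ := by
    rwa [setLIntegral_congr_fun measurableSet_ball fun z hz => by rw [hg' z hz]]
  obtain ⟨Φ, hΦ, hΦF⟩ := exists_continuousOn_closedBall_extension hF hg hFg hD
  obtain ⟨h, hh, -, H⟩ := exists_eVariationOn_boundary_le hF hg hFg hD hΦ hΦF
  have hF0 : F 0 ∉ Set.range γ := by
    rw [← Set.mem_compl_iff, ← hunion]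
    exact Or.inl (hFbij.mapsTo (by simp))
  obtain ⟨hβi, hβr⟩ := boundary_injOn_and_range hγc hγp hγi hF hinj hΦ hΦF hF0
    (boundary_value_mem_range hΩso hdisj hunion hF hFbij hΦ hΦF) hh
    fun a b hab hb => (H a b hab hb).1
  rw [← hβr]
  exact exists_arc_length_parametrization
    (hΦ.comp_continuous (continuous_circleMap 0 1) fun t => by simp)
    (fun t => congrArg Φ (periodic_circleMap 0 1 t)) hβi hh fun a b hab hb => (H a b hab hb).2
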